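/- Let k ∈ ℤ and m ∈ ℕ with m ≥ 1, and let φ be a weak Jacobi form of weight 2k and index m with Fourier expansion φ(τ,z) = Σ_{n≥0, l∈ℤ} f(n,l) q^n ζ^l. If f(n,l) ∈ ℤ for all n with 0 ≤ n ≤ ⌊(m+k)/6⌋ and all l ∈ ℤ, then f(n,l) ∈ ℤ for all n ∈ ℕ and all l ∈ ℤ. -/

import Mathlib

noncomputable section

open Complex

namespace JacobiPaper

/-- `e2 w = e^{2 π i w}`. -/
def e2 (w : ℂ) : ℂ := Complex.exp (2 * (Real.pi : ℂ) * Complex.I * w)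

/-- `q = e^{2 π i τ}`. -/
def qC (τ : ℂ) : ℂ := e2 τ

/-- `ζ = e^{2 π i z}`. -/
def zetaC (z : ℂ) : ℂ := e2 z

/-- The Dedekind eta function `η(τ) = q^{1/24} ∏_{n ≥ 1} (1 - qⁿ)`. -/
def eta (τ : ℂ) : ℂ :=
  Complex.exp ((Real.pi : ℂ) * Complex.I * τ / 12) * ∏' n : ℕ, (1 - qC τ ^ (n + 1))

/-- The odd Jacobi theta function
`ϑ(τ,z) = q^{1/8} (ζ^{1/2} - ζ^{-1/2}) ∏_{n ≥ 1} (1 - qⁿζ)(1 - qⁿζ⁻¹)(1 - qⁿ)`. -/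
def theta (τ z : ℂ) : ℂ :=
  Complex.exp ((Real.pi : ℂ) * Complex.I * τ / 4) *
    (Complex.exp ((Real.pi : ℂ) * Complex.I * z) - Complex.exp (-((Real.pi : ℂ) * Complex.I * z))) *
    ∏' n : ℕ,
      ((1 - qC τ ^ (n + 1) * zetaC z) * (1 - qC τ ^ (n + 1) * (zetaC z)⁻¹) * (1 - qC τ ^ (n + 1)))

/-- `ϑ₀₀(τ,z) = Σ_{n ∈ ℤ} q^{n²/2} ζⁿ`. -/
def theta00 (τ z : ℂ) : ℂ :=
  ∑' n : ℤ, Complex.exp ((Real.pi : ℂ) * Complex.I * (n : ℂ) ^ 2 * τ +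
    2 * (Real.pi : ℂ) * Complex.I * (n : ℂ) * z)

/-- `ϑ₀₁(τ,z) = Σ_{n ∈ ℤ} (-1)ⁿ q^{n²/2} ζⁿ`. -/
def theta01 (τ z : ℂ) : ℂ :=
  ∑' n : ℤ, (-1 : ℂ) ^ n * Complex.exp ((Real.pi : ℂ) * Complex.I * (n : ℂ) ^ 2 * τ +
    2 * (Real.pi : ℂ) * Complex.I * (n : ℂ) * z)

/-- `ϑ₁₀(τ,z) = q^{1/8} ζ^{1/2} Σ_{n ∈ ℤ} q^{n(n+1)/2} ζⁿ`. -/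
def theta10 (τ z : ℂ) : ℂ :=
  Complex.exp ((Real.pi : ℂ) * Complex.I * τ / 4) * Complex.exp ((Real.pi : ℂ) * Complex.I * z) *
    ∑' n : ℤ, Complex.exp ((Real.pi : ℂ) * Complex.I * (n : ℂ) * ((n : ℂ) + 1) * τ +
      2 * (Real.pi : ℂ) * Complex.I * (n : ℂ) * z)

/-- `ξ₀₀(τ,z) = ϑ₀₀(τ,z)/ϑ₀₀(τ,0)`. -/
def xi00 (τ z : ℂ) : ℂ := theta00 τ z / theta00 τ 0

/-- `ξ₀₁(τ,z) = ϑ₀₁(τ,z)/ϑ₀₁(τ,0)`. -/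
def xi01 (τ z : ℂ) : ℂ := theta01 τ z / theta01 τ 0

/-- `ξ₁₀(τ,z) = ϑ₁₀(τ,z)/ϑ₁₀(τ,0)`. -/
def xi10 (τ z : ℂ) : ℂ := theta10 τ z / theta10 τ 0

/-- The weak Jacobi form `φ_{0,1} = 4(ξ₀₀² + ξ₀₁² + ξ₁₀²)`. -/
def phi01 (τ z : ℂ) : ℂ := 4 * (xi00 τ z ^ 2 + xi01 τ z ^ 2 + xi10 τ z ^ 2)

/-- The weak Jacobi form `φ_{0,2}(τ,z) = 2(ξ₀₀ + ξ₀₁ + ξ₁₀)(τ,2z)`. -/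
def phi02 (τ z : ℂ) : ℂ := 2 * (xi00 τ (2 * z) + xi01 τ (2 * z) + xi10 τ (2 * z))

/-- The weak Jacobi form `φ_{0,3}(τ,z) = ϑ(τ,2z)²/ϑ(τ,z)²`. -/
def phi03 (τ z : ℂ) : ℂ := theta τ (2 * z) ^ 2 / theta τ z ^ 2

/-- The weak Jacobi form `φ_{0,4}(τ,z) = ϑ(τ,3z)/ϑ(τ,z)`. -/
def phi04 (τ z : ℂ) : ℂ := theta τ (3 * z) / theta τ z

/-- The weak Jacobi form `φ_{-2,1}(τ,z) = ϑ(τ,z)²/η(τ)⁶`. -/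
def phiM21 (τ z : ℂ) : ℂ := theta τ z ^ 2 / eta τ ^ 6

/-- The divisor power sum `σ_k(n)`. -/
def sigma' (k n : ℕ) : ℕ := ∑ d ∈ n.divisors, d ^ k

/-- The normalized Eisenstein series `E_k(τ) = 1 - (2k/B_k) Σ_{n ≥ 1} σ_{k-1}(n) qⁿ`. -/
def Eis (k : ℕ) (τ : ℂ) : ℂ :=
  1 - (2 * (k : ℂ) / ((bernoulli k : ℚ) : ℂ)) *
    ∑' n : ℕ, (sigma' (k - 1) (n + 1) : ℂ) * qC τ ^ (n + 1)

/-- The discriminant cusp form `Δ = η²⁴`. -/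
def Delta (τ : ℂ) : ℂ := eta τ ^ 24

/-- The modular invariant `j = E₄³/Δ`. -/
def jInv (τ : ℂ) : ℂ := Eis 4 τ ^ 3 / Delta τ

/-- A choice of `(a, b)` with `a d - b c = 1` completing a coprime pair `(c, d)` to a matrix
`(a b; c d) ∈ SL₂(ℤ)`. -/
def bezout (c d : ℤ) : ℤ × ℤ :=
  haveI : Decidable (∃ ab : ℤ × ℤ, ab.1 * d - ab.2 * c = 1) := Classical.propDecidable _
  if h : ∃ ab : ℤ × ℤ, ab.1 * d - ab.2 * c = 1 then h.choose else 0

/-- The summand `(cτ+d)^{-k} Σ_{l ∈ ℤ} e^{2πim(l²(aτ+b)/(cτ+d) + 2lz/(cτ+d) - cz²/(cτ+d))}`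
of the Jacobi–Eisenstein series attached to a coprime pair `(c,d)`; it does not depend on the
choice of `(a,b)` completing `(c,d)` to an element of `SL₂(ℤ)`. -/
def EisJSummand (k m : ℕ) (τ z : ℂ) (c d : ℤ) : ℂ :=
  ((c : ℂ) * τ + (d : ℂ)) ^ (-(k : ℤ)) *
    ∑' l : ℤ, e2 ((m : ℂ) * ((l : ℂ) ^ 2 * (((bezout c d).1 : ℂ) * τ + ((bezout c d).2 : ℂ)) /
        ((c : ℂ) * τ + (d : ℂ)) +
      2 * (l : ℂ) * z / ((c : ℂ) * τ + (d : ℂ)) - (c : ℂ) * z ^ 2 / ((c : ℂ) * τ + (d : ℂ))))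

/-- The Jacobi–Eisenstein series `E_{k,m}` of weight `k` and index `m`. -/
def EisJ (k m : ℕ) (τ z : ℂ) : ℂ :=
  (1 / 2) * ∑' p : {p : ℤ × ℤ // IsCoprime p.1 p.2}, EisJSummand k m τ z p.1.1 p.1.2

/-- `F_{6,3} = (1/2)(E_{6,1} φ_{0,2} - E₆ φ_{0,3})`. -/
def F63 (τ z : ℂ) : ℂ := (1 / 2) * (EisJ 6 1 τ z * phi02 τ z - Eis 6 τ * phi03 τ z)

/-- A weak Jacobi form of weight `k ∈ ℤ` and index `m ∈ ℕ`: a holomorphic function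
`φ : ℍ × ℂ → ℂ` satisfying the two Jacobi transformation laws and having a Fourier expansion
`φ(τ,z) = Σ_{n ≥ 0, l ∈ ℤ} f(n,l) qⁿ ζˡ`. -/
def IsWeakJacobiForm (k : ℤ) (m : ℕ) (φ : ℂ → ℂ → ℂ) (f : ℕ → ℤ → ℂ) : Prop :=
  DifferentiableOn ℂ (fun p : ℂ × ℂ => φ p.1 p.2) {p : ℂ × ℂ | 0 < p.1.im} ∧
  (∀ a b c d : ℤ, a * d - b * c = 1 → ∀ τ z : ℂ, 0 < τ.im →
    φ (((a : ℂ) * τ + (b : ℂ)) / ((c : ℂ) * τ + (d : ℂ))) (z / ((c : ℂ) * τ + (d : ℂ))) =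
      ((c : ℂ) * τ + (d : ℂ)) ^ k *
        e2 ((m : ℂ) * ((c : ℂ) * z ^ 2 / ((c : ℂ) * τ + (d : ℂ)))) * φ τ z) ∧
  (∀ x y : ℤ, ∀ τ z : ℂ, 0 < τ.im →
    φ τ (z + (x : ℂ) * τ + (y : ℂ)) =
      e2 (-(m : ℂ) * ((x : ℂ) ^ 2 * τ + 2 * (x : ℂ) * z)) * φ τ z) ∧
  (∀ τ z : ℂ, 0 < τ.im →
    HasSum (fun p : ℕ × ℤ => f p.1 p.2 * e2 ((p.1 : ℂ) * τ + (p.2 : ℂ) * z)) (φ τ z))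

/-- A weakly holomorphic Jacobi form of weight `0` and index `m ∈ ℕ`: as a weak Jacobi form,
but the Fourier expansion `φ(τ,z) = Σ_{n ≥ n₀, l ∈ ℤ} f(n,l) qⁿ ζˡ` may contain finitely many
negative powers of `q`. -/
def IsWeaklyHolomorphicJacobiForm0 (m : ℕ) (φ : ℂ → ℂ → ℂ) (f : ℤ → ℤ → ℂ) : Prop :=
  DifferentiableOn ℂ (fun p : ℂ × ℂ => φ p.1 p.2) {p : ℂ × ℂ | 0 < p.1.im} ∧
  (∀ a b c d : ℤ, a * d - b * c = 1 → ∀ τ z : ℂ, 0 < τ.im →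
    φ (((a : ℂ) * τ + (b : ℂ)) / ((c : ℂ) * τ + (d : ℂ))) (z / ((c : ℂ) * τ + (d : ℂ))) =
      e2 ((m : ℂ) * ((c : ℂ) * z ^ 2 / ((c : ℂ) * τ + (d : ℂ)))) * φ τ z) ∧
  (∀ x y : ℤ, ∀ τ z : ℂ, 0 < τ.im →
    φ τ (z + (x : ℂ) * τ + (y : ℂ)) =
      e2 (-(m : ℂ) * ((x : ℂ) ^ 2 * τ + 2 * (x : ℂ) * z)) * φ τ z) ∧
  (∃ n₀ : ℤ, ∀ n : ℤ, n < n₀ → ∀ l : ℤ, f n l = 0) ∧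
  (∀ τ z : ℂ, 0 < τ.im →
    HasSum (fun p : ℤ × ℤ => f p.1 p.2 * e2 ((p.1 : ℂ) * τ + (p.2 : ℂ) * z)) (φ τ z))

/-- A function `φ` on `ℍ × ℂ` has integral Fourier coefficients if it is the sum of a Fourier
series `Σ_{n ≥ 0, l ∈ ℤ} f(n,l) qⁿ ζˡ` with all `f(n,l) ∈ ℤ`. -/
def HasIntegralFourierExpansion (φ : ℂ → ℂ → ℂ) : Prop :=
  ∃ f : ℕ → ℤ → ℤ, ∀ τ z : ℂ, 0 < τ.im →
    HasSum (fun p : ℕ × ℤ => (f p.1 p.2 : ℂ) * e2 ((p.1 : ℂ) * τ + (p.2 : ℂ) * z)) (φ τ z)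

section

open scoped ModularForm Topology

/-- The weighted `ℓ¹`-norm `∑ |aᵢ| ρⁱ` of a polynomial. -/
def wnorm (ρ : ℝ) (P : Polynomial ℂ) : ℝ := P.sum fun i a => ‖a‖ * ρ ^ i

theorem hasSum_wnorm (ρ : ℝ) (P : Polynomial ℂ) :
    HasSum (fun i => ‖P.coeff i‖ * ρ ^ i) (wnorm ρ P) := by
  unfold wnorm Polynomial.sum
  apply hasSum_sum_of_ne_finset_zero
  intro b hb
  simp [Polynomial.notMem_support_iff.mp hb]

theorem wnorm_nonneg {ρ : ℝ} (hρ : 0 ≤ ρ) (P : Polynomial ℂ) : 0 ≤ wnorm ρ P :=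
  (hasSum_wnorm ρ P).nonneg fun _ => by positivity

theorem coeff_le_wnorm {ρ : ℝ} (hρ : 0 ≤ ρ) (P : Polynomial ℂ) (i : ℕ) :
    ‖P.coeff i‖ * ρ ^ i ≤ wnorm ρ P :=
  le_hasSum (hasSum_wnorm ρ P) i fun _ _ => by positivity

theorem wnorm_add_le {ρ : ℝ} (hρ : 0 ≤ ρ) (P Q : Polynomial ℂ) :
    wnorm ρ (P + Q) ≤ wnorm ρ P + wnorm ρ Q := by
  refine hasSum_le (fun i => ?_) (hasSum_wnorm ρ (P + Q))
    ((hasSum_wnorm ρ P).add (hasSum_wnorm ρ Q))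
  rw [Polynomial.coeff_add, ← add_mul]
  gcongr
  exact norm_add_le _ _

theorem wnorm_zero (ρ : ℝ) : wnorm ρ 0 = 0 := by simp [wnorm]

theorem wnorm_neg (ρ : ℝ) (P : Polynomial ℂ) : wnorm ρ (-P) = wnorm ρ P := by
  refine (hasSum_wnorm ρ (-P)).unique ?_
  simpa using hasSum_wnorm ρ P

theorem wnorm_C (ρ : ℝ) (a : ℂ) : wnorm ρ (Polynomial.C a) = ‖a‖ := by
  simp [wnorm, Polynomial.sum_C_index]

theorem wnorm_X (ρ : ℝ) : wnorm ρ Polynomial.X = ρ := by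
  simp [wnorm, Polynomial.sum_X_index]

theorem wnorm_sum_le {ρ : ℝ} (hρ : 0 ≤ ρ) {ι : Type*} (s : Finset ι) (P : ι → Polynomial ℂ) :
    wnorm ρ (∑ i ∈ s, P i) ≤ ∑ i ∈ s, wnorm ρ (P i) :=
  Finset.le_sum_of_subadditive _ (wnorm_zero ρ).le (wnorm_add_le hρ) _ _

theorem wnorm_mul_le {ρ : ℝ} (hρ : 0 ≤ ρ) (P Q : Polynomial ℂ) :
    wnorm ρ (P * Q) ≤ wnorm ρ P * wnorm ρ Q := by
  have hP := hasSum_wnorm ρ P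
  have hQ := hasSum_wnorm ρ Q
  have hP' : Summable fun i => ‖‖P.coeff i‖ * ρ ^ i‖ := by
    simpa [abs_of_nonneg hρ] using hP.summable
  have hQ' : Summable fun i => ‖‖Q.coeff i‖ * ρ ^ i‖ := by
    simpa [abs_of_nonneg hρ] using hQ.summable
  have key := tsum_mul_tsum_eq_tsum_sum_antidiagonal_of_summable_norm hP' hQ'
  have hs := (summable_norm_sum_mul_antidiagonal_of_summable_norm hP' hQ').of_norm
  rw [hP.tsum_eq, hQ.tsum_eq] at key
  rw [key]
  refine hasSum_le (fun n => ?_) (hasSum_wnorm ρ (P * Q)) hs.hasSum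
  rw [Polynomial.coeff_mul]
  calc _ ≤ (∑ x ∈ Finset.HasAntidiagonal.antidiagonal n, ‖P.coeff x.1 * Q.coeff x.2‖) * ρ ^ n := by
        gcongr
        exact norm_sum_le _ _
    _ = _ := by
        rw [Finset.sum_mul]
        refine Finset.sum_congr rfl fun x hx => ?_
        rw [← Finset.HasAntidiagonal.mem_antidiagonal.mp hx, pow_add, norm_mul]
        ring

theorem wnorm_mono {ρ σ : ℝ} (hρ : 0 ≤ ρ) (h : ρ ≤ σ) (P : Polynomial ℂ) :
    wnorm ρ P ≤ wnorm σ P :=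
  hasSum_le (fun i => by gcongr) (hasSum_wnorm ρ P) (hasSum_wnorm σ P)

theorem norm_eval_le_wnorm {ρ : ℝ} {s : ℂ} (h : ‖s‖ ≤ ρ) (P : Polynomial ℂ) :
    ‖P.eval s‖ ≤ wnorm ρ P := by
  rw [Polynomial.eval_eq_sum]
  unfold wnorm Polynomial.sum
  refine (norm_sum_le _ _).trans (Finset.sum_le_sum fun i _ => ?_)
  rw [norm_mul, norm_pow]
  exact mul_le_mul_of_nonneg_left (pow_le_pow_left₀ (norm_nonneg s) h i) (norm_nonneg _)

/-- Absolute convergence of `∑ Fₙ(s) qⁿ` for all `s ∈ ℂ` and all `|q| < 1`. -/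
def Conv (F : PowerSeries (Polynomial ℂ)) : Prop :=
  ∀ ρ : ℝ, 1 ≤ ρ → ∀ t : ℝ, 0 < t → t < 1 →
    Summable fun n => wnorm ρ (PowerSeries.coeff n F) * t ^ n

theorem Conv.mul {F G : PowerSeries (Polynomial ℂ)} (hF : Conv F) (hG : Conv G) :
    Conv (F * G) := by
  intro ρ hρ t ht ht1
  have hρ0 : 0 ≤ ρ := by linarith
  have nn : ∀ (H : PowerSeries (Polynomial ℂ)) (n : ℕ),
      0 ≤ wnorm ρ (PowerSeries.coeff n H) * t ^ n := fun H n =>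
    mul_nonneg (wnorm_nonneg hρ0 _) (by positivity)
  have key := summable_norm_sum_mul_antidiagonal_of_summable_norm
    (hF ρ hρ t ht ht1).norm (hG ρ hρ t ht ht1).norm
  refine Summable.of_nonneg_of_le (nn _) (fun n => ?_) key
  refine le_trans ?_ (le_abs_self _)
  rw [PowerSeries.coeff_mul]
  calc _ ≤ (∑ x ∈ Finset.HasAntidiagonal.antidiagonal n, wnorm ρ (PowerSeries.coeff x.1 F) *
        wnorm ρ (PowerSeries.coeff x.2 G)) * t ^ n := by
        gcongr
        exact (wnorm_sum_le hρ0 _ _).trans (Finset.sum_le_sum fun x _ => wnorm_mul_le hρ0 _ _)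
    _ = _ := by
        rw [Finset.sum_mul]
        refine Finset.sum_congr rfl fun x hx => ?_
        rw [← Finset.HasAntidiagonal.mem_antidiagonal.mp hx, pow_add]
        ring

/-- The ring of everywhere convergent power series in `q` with coefficients in `ℂ[s]`. -/
def CR : Subring (PowerSeries (Polynomial ℂ)) where
  carrier := {F | Conv F}
  mul_mem' := Conv.mul
  one_mem' := by
    intro ρ hρ t ht ht1
    refine summable_of_ne_finset_zero (s := {0}) fun n hn => ?_
    have : n ≠ 0 := by simpa using hn
    simp [PowerSeries.coeff_one, this, wnorm_zero]
  zero_mem' := by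
    intro ρ hρ t ht ht1
    simp [wnorm_zero]
  add_mem' := by
    intro F G hF hG ρ hρ t ht ht1
    refine Summable.of_nonneg_of_le (fun n => mul_nonneg (wnorm_nonneg (by linarith) _)
      (by positivity)) (fun n => ?_) ((hF ρ hρ t ht ht1).add (hG ρ hρ t ht ht1))
    rw [← add_mul, map_add]
    gcongr
    exact wnorm_add_le (by linarith) _ _
  neg_mem' := by
    intro F hF ρ hρ t ht ht1
    simpa [wnorm_neg] using hF ρ hρ t ht ht1

/-- The `n`-th coefficient, a polynomial in `s`. -/
def cf (n : ℕ) (F : CR) : Polynomial ℂ := PowerSeries.coeff n (F : PowerSeries (Polynomial ℂ))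

theorem CR.ext_cf {F G : CR} (h : ∀ n, cf n F = cf n G) : F = G :=
  Subtype.ext (PowerSeries.ext h)

@[simp] theorem cf_add (n : ℕ) (F G : CR) : cf n (F + G) = cf n F + cf n G := rfl
@[simp] theorem cf_sub (n : ℕ) (F G : CR) : cf n (F - G) = cf n F - cf n G := by
  simp [cf]
@[simp] theorem cf_zero' (n : ℕ) : cf n 0 = 0 := rfl
@[simp] theorem cf_zero_mul (F G : CR) : cf 0 (F * G) = cf 0 F * cf 0 G := by
  simp [cf]
@[simp] theorem cf_zero_pow (F : CR) (n : ℕ) : cf 0 (F ^ n) = cf 0 F ^ n := by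
  simp [cf]
@[simp] theorem cf_zero_one : cf 0 1 = 1 := by
  simp [cf]

theorem cf_mul (n : ℕ) (F G : CR) :
    cf n (F * G) = ∑ x ∈ Finset.HasAntidiagonal.antidiagonal n, cf x.1 F * cf x.2 G :=
  PowerSeries.coeff_mul _ _ _

theorem summable_wnorm (F : CR) {ρ t : ℝ} (hρ : 0 ≤ ρ) (ht : 0 ≤ t) (ht1 : t < 1) :
    Summable fun n => wnorm ρ (cf n F) * t ^ n := by
  have h1 : (0:ℝ) < (t + 1) / 2 := by linarith
  have := F.2 (max ρ 1) (le_max_right _ _) ((t + 1) / 2) h1 (by linarith)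
  refine Summable.of_nonneg_of_le (fun n => mul_nonneg (wnorm_nonneg hρ _) (by positivity))
    (fun n => ?_) this
  have h3 : t ≤ (t + 1) / 2 := by linarith
  have h4 := wnorm_nonneg (le_max_of_le_left hρ : 0 ≤ max ρ 1) (cf n F)
  change _ ≤ wnorm (max ρ 1) (cf n F) * _
  gcongr
  exact wnorm_mono hρ (le_max_left _ _) _

theorem summable_norm_eval (F : CR) {q : ℂ} (hq : ‖q‖ < 1) (s : ℂ) :
    Summable fun n => ‖(cf n F).eval s * q ^ n‖ := by
  refine Summable.of_nonneg_of_le (fun n => norm_nonneg _) (fun n => ?_)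
    (summable_wnorm F (norm_nonneg s) (norm_nonneg q) hq)
  rw [norm_mul, norm_pow]
  gcongr
  exact norm_eval_le_wnorm le_rfl _

/-- Evaluation of a convergent series at a point `(q, s)`, as a ring homomorphism. -/
def evq (q : ℂ) (hq : ‖q‖ < 1) (s : ℂ) : CR →+* ℂ where
  toFun F := ∑' n, (cf n F).eval s * q ^ n
  map_one' := by
    rw [tsum_eq_single 0]
    · simp
    · intro n hn
      simp [cf, PowerSeries.coeff_one, hn]
  map_zero' := by simp
  map_add' F G := by
    rw [← (summable_norm_eval F hq s).of_norm.tsum_add (summable_norm_eval G hq s).of_norm]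
    simp [add_mul]
  map_mul' F G := by
    rw [tsum_mul_tsum_eq_tsum_sum_antidiagonal_of_summable_norm
      (summable_norm_eval F hq s) (summable_norm_eval G hq s)]
    congr 1
    ext n
    rw [cf_mul, Polynomial.eval_finsetSum, Finset.sum_mul]
    refine Finset.sum_congr rfl fun x hx => ?_
    rw [← Finset.HasAntidiagonal.mem_antidiagonal.mp hx, pow_add, Polynomial.eval_mul]
    ring

theorem hasSum_evq (q : ℂ) (hq : ‖q‖ < 1) (s : ℂ) (F : CR) :
    HasSum (fun n => (cf n F).eval s * q ^ n) (evq q hq s F) :=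
  (summable_norm_eval F hq s).of_norm.hasSum

theorem norm_e2_lt_one (τ : UpperHalfPlane) : ‖e2 τ‖ < 1 := by
  rw [e2, Complex.norm_exp]
  have h := τ.im_pos
  have : (2 * (Real.pi : ℂ) * Complex.I * (τ : ℂ)).re = -(2 * Real.pi * τ.im) := by
    simp
  rw [this, Real.exp_lt_one_iff]
  have := Real.pi_pos
  nlinarith [mul_pos this h]

theorem e2_add (a b : ℂ) : e2 (a + b) = e2 a * e2 b := by
  simp [e2, mul_add, Complex.exp_add]

theorem e2_zero : e2 0 = 1 := by simp [e2]

theorem e2_ne_zero (a : ℂ) : e2 a ≠ 0 := Complex.exp_ne_zero _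

theorem e2_neg (a : ℂ) : e2 (-a) = (e2 a)⁻¹ := by simp [e2, Complex.exp_neg]

theorem e2_nat_mul (n : ℕ) (a : ℂ) : e2 (n * a) = e2 a ^ n := by
  rw [e2, e2, ← Complex.exp_nat_mul]
  ring_nf

theorem e2_int_mul (n : ℤ) (a : ℂ) : e2 (n * a) = e2 a ^ n := by
  rw [e2, e2, ← Complex.exp_int_mul]
  ring_nf

theorem e2_one : e2 1 = 1 := by simp [e2, Complex.exp_two_pi_mul_I]

theorem e2_int (n : ℤ) : e2 n = 1 := by
  have := e2_int_mul n 1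
  rwa [mul_one, e2_one, one_zpow] at this

/-- The variable `s = ζ + ζ⁻¹ - 2`. -/
def sv (z : ℂ) : ℂ := e2 z + e2 (-z) - 2

/-- Evaluation of a convergent series at `(τ, z)`. -/
def ev (τ : UpperHalfPlane) (z : ℂ) : CR →+* ℂ := evq (e2 τ) (norm_e2_lt_one τ) (sv z)

theorem hasSum_ev (τ : UpperHalfPlane) (z : ℂ) (F : CR) :
    HasSum (fun n => (cf n F).eval (sv z) * e2 τ ^ n) (ev τ z F) :=
  hasSum_evq _ _ _ _

theorem conv_X : Conv PowerSeries.X := by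
  intro ρ hρ t ht ht1
  refine summable_of_ne_finset_zero (s := {1}) fun n hn => ?_
  have : n ≠ 1 := by simpa using hn
  simp [PowerSeries.coeff_X, this, wnorm_zero]

/-- The variable `q` as a convergent series. -/
def qX : CR := ⟨PowerSeries.X, conv_X⟩

theorem cf_succ_qX_mul (n : ℕ) (F : CR) : cf (n + 1) (qX * F) = cf n F :=
  PowerSeries.coeff_succ_X_mul _ _

@[simp] theorem cf_zero_qX : cf 0 qX = 0 := by
  simp [cf, qX]

theorem ev_qX (τ : UpperHalfPlane) (z : ℂ) : ev τ z qX = e2 τ := by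
  refine (hasSum_ev τ z qX).unique ?_
  have := hasSum_single (f := fun n => (cf n qX).eval (sv z) * e2 τ ^ n) 1 (fun n hn => by
    simp [cf, qX, PowerSeries.coeff_X, hn])
  simpa [cf, qX] using this

theorem exists_eq_qX_mul {F : CR} (h : cf 0 F = 0) : ∃ G : CR, F = qX * G := by
  obtain ⟨G, hG⟩ := PowerSeries.X_dvd_iff.mpr (by simpa [cf] using h)
  refine ⟨⟨G, fun ρ hρ t ht ht1 => ?_⟩, Subtype.ext hG⟩
  have h1 := (summable_nat_add_iff 1).mpr (F.2 ρ hρ t ht ht1)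
  rw [hG] at h1
  refine (h1.mul_right t⁻¹).congr fun n => ?_
  rw [PowerSeries.coeff_succ_X_mul, pow_succ]
  field_simp

/-- The subring of convergent series with coefficients in `ℤ[s]`. -/
def ZR : Subring CR :=
  (PowerSeries.map (Polynomial.mapRingHom (Int.castRingHom ℂ))).range.comap CR.subtype

theorem mem_ZR_iff {F : CR} :
    F ∈ ZR ↔ ∀ n, ∃ P : Polynomial ℤ, P.map (Int.castRingHom ℂ) = cf n F := by
  constructor
  · rintro ⟨G, hG⟩ n
    exact ⟨PowerSeries.coeff n G, by
      have := congrArg (PowerSeries.coeff n) hG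
      simpa [cf] using this⟩
  · intro h
    choose P hP using h
    refine ⟨PowerSeries.mk P, ?_⟩
    ext1 n
    simp only [PowerSeries.coeff_map, PowerSeries.coeff_mk, Polynomial.coe_mapRingHom, hP]
    rfl

theorem qX_mem_ZR : qX ∈ ZR := ⟨PowerSeries.X, by simp [qX]⟩

theorem mem_ZR_of_qX_mul {F : CR} (h : qX * F ∈ ZR) : F ∈ ZR := by
  rw [mem_ZR_iff] at h ⊢
  intro n
  rw [← cf_succ_qX_mul]
  exact h (n + 1)

/-- The transformation laws of a weak Jacobi form of weight `2k` and index `m`. -/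
structure Jac (k : ℤ) (m : ℕ) (F : CR) : Prop where
  mod : ∀ (τ : UpperHalfPlane) (z : ℂ), ev (ModularGroup.S • τ) (z / τ) F =
    (τ : ℂ) ^ (2 * k) * e2 (m * (z ^ 2 / τ)) * ev τ z F
  ell : ∀ (τ : UpperHalfPlane) (z : ℂ), ev τ (z + τ) F = e2 (-(m * (τ + 2 * z))) * ev τ z F

namespace Jac

variable {k k' : ℤ} {m m' : ℕ} {F G : CR}

theorem add (hF : Jac k m F) (hG : Jac k m G) : Jac k m (F + G) where
  mod τ z := by rw [map_add, map_add, hF.mod, hG.mod]; ring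
  ell τ z := by rw [map_add, map_add, hF.ell, hG.ell]; ring

theorem sub (hF : Jac k m F) (hG : Jac k m G) : Jac k m (F - G) where
  mod τ z := by rw [map_sub, map_sub, hF.mod, hG.mod]; ring
  ell τ z := by rw [map_sub, map_sub, hF.ell, hG.ell]; ring

theorem mul (hF : Jac k m F) (hG : Jac k' m' G) : Jac (k + k') (m + m') (F * G) where
  mod τ z := by
    rw [map_mul, map_mul, hF.mod, hG.mod, mul_add, zpow_add₀ τ.ne_zero, Nat.cast_add, add_mul,
      e2_add]
    ring
  ell τ z := by
    rw [map_mul, map_mul, hF.ell, hG.ell, Nat.cast_add, add_mul, neg_add, e2_add]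
    ring

theorem cast (hF : Jac k m F) (hk : k = k') (hm : m = m') : Jac k' m' F := by
  subst hk hm; exact hF

theorem intCast (n : ℤ) : Jac 0 0 (n : CR) where
  mod τ z := by simp [e2_zero]
  ell τ z := by simp [e2_zero]

theorem int_mul (n : ℤ) (hF : Jac k m F) : Jac k m (n * F) :=
  ((intCast n).mul hF).cast (by simp) (by simp)

theorem pow (hF : Jac k m F) (n : ℕ) : Jac (n * k) (n * m) (F ^ n) := by
  induction n with
  | zero => simpa using intCast 1
  | succ n ih =>
    rw [pow_succ]
    exact (ih.mul hF).cast (by push_cast; ring) (by ring)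

theorem of_int_mul {n : ℤ} (hn : n ≠ 0) (hF : Jac k m (n * F)) : Jac k m F := by
  have hn' : (n : ℂ) ≠ 0 := by exact_mod_cast hn
  constructor
  · intro τ z
    have := hF.mod τ z
    rw [map_mul, map_mul, map_intCast, map_intCast] at this
    apply mul_left_cancel₀ hn'
    rw [this]; ring
  · intro τ z
    have := hF.ell τ z
    rw [map_mul, map_mul, map_intCast, map_intCast] at this
    apply mul_left_cancel₀ hn'
    rw [this]; ring

end Jac

section

theorem hasSum_of_eq {ι : Type*} {f g : ι → ℂ} {a : ℂ} (h : HasSum f a) (e : ∀ i, g i = f i) :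
    HasSum g a := by rwa [funext e]

theorem continuous_e2 : Continuous e2 := by unfold e2; fun_prop

theorem norm_e2_real (x : ℝ) : ‖e2 x‖ = 1 := by
  have : 2 * (Real.pi : ℂ) * Complex.I * x = ((2 * Real.pi * x : ℝ) : ℂ) * Complex.I := by
    push_cast; ring
  rw [e2, this, Complex.norm_exp_ofReal_mul_I]

theorem integral_e2_int (n : ℤ) : ∫ x in (0:ℝ)..1, e2 (n * x) = if n = 0 then 1 else 0 := by
  split_ifs with h
  · simp [h, e2_zero]
  · have hc : (2 * (Real.pi : ℂ) * Complex.I * n) ≠ 0 := by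
      simp [h, Real.pi_ne_zero]
    have := integral_exp_mul_complex (a := 0) (b := 1) hc
    simp only [e2, ← mul_assoc]
    rw [this]
    have h1 := e2_int n
    unfold e2 at h1
    simp [h1]

/-- Uniqueness of the coefficients of an absolutely convergent Fourier series. -/
theorem eq_zero_of_fourier {ι : Type*} [Countable ι] {e : ι → ℤ} (he : Function.Injective e)
    {a : ι → ℂ} (ha : Summable fun i => ‖a i‖)
    (h : ∀ x : ℝ, HasSum (fun i => a i * e2 (e i * x)) 0) (j : ι) : a j = 0 := by
  have key := intervalIntegral.hasSum_integral_of_dominated_convergence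
    (μ := MeasureTheory.volume) (a := 0) (b := 1)
    (F := fun i (x : ℝ) => a i * e2 ((e i - e j : ℤ) * x)) (f := fun _ => 0)
    (fun i _ => ‖a i‖) (fun i => Continuous.aestronglyMeasurable (by
      have := continuous_e2
      fun_prop)) (fun i => Filter.Eventually.of_forall fun x _ => by
        have h1 := norm_e2_real ((e i - e j : ℤ) * x)
        push_cast at h1 ⊢
        rw [norm_mul, h1, mul_one])
    (Filter.Eventually.of_forall fun _ _ => ha) (by simp)
    (Filter.Eventually.of_forall fun x _ => by
      have := (h x).mul_right (e2 (-(e j * x)))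
      rw [zero_mul] at this
      refine hasSum_of_eq this fun i => ?_
      rw [mul_assoc, ← e2_add]
      congr 2
      push_cast; ring)
  classical
  have h2 : ∀ i, ∫ x in (0:ℝ)..1, a i * e2 ((e i - e j : ℤ) * x) = if i = j then a i else 0 := by
    intro i
    rw [intervalIntegral.integral_const_mul, integral_e2_int]
    simp [sub_eq_zero, he.eq_iff]
  simp only [h2, intervalIntegral.integral_zero] at key
  have h3 := hasSum_ite_eq j (a j)
  refine h3.unique (hasSum_of_eq key fun i => ?_)
  by_cases hij : i = j <;> simp [hij]

theorem eq_zero_of_qseries {a : ℕ → ℂ}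
    (h : ∀ τ : UpperHalfPlane, HasSum (fun n => a n * e2 τ ^ n) 0) (n : ℕ) : a n = 0 := by
  have key : a n * e2 I ^ n = 0 := by
    refine eq_zero_of_fourier (e := fun n : ℕ => (n : ℤ)) Nat.cast_injective
      (a := fun n => a n * e2 I ^ n) ?_ ?_ n
    · simpa using (h UpperHalfPlane.I).summable.norm
    · intro x
      have := h ⟨I + x, by simp⟩
      simpa [e2_add, mul_pow, e2_nat_mul, mul_assoc] using this
  simpa [e2_ne_zero] using key

section Elliptic

variable {m : ℕ} {f : ℕ → ℤ → ℂ} {φ : UpperHalfPlane → ℂ → ℂ}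

theorem hasSum_fourier_z
    (hs : ∀ (τ : UpperHalfPlane) (z : ℂ),
      HasSum (fun p : ℕ × ℤ => f p.1 p.2 * e2 (p.1 * τ + p.2 * z)) (φ τ z))
    (τ : UpperHalfPlane) (z : ℂ) :
    HasSum (fun l : ℤ => (∑' n, f n l * e2 τ ^ n) * e2 z ^ l) (φ τ z) := by
  have h1 := (Equiv.prodComm ℤ ℕ).hasSum_iff.mpr (hs τ z)
  have h2 := h1.prod_fiberwise (fun l => (h1.summable.comp_injective
    (Prod.mk_right_injective l)).hasSum)
  refine hasSum_of_eq h2 fun l => ?_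
  rw [← tsum_mul_right]
  refine tsum_congr fun n => ?_
  simp [e2_add, e2_nat_mul, e2_int_mul, mul_assoc]

theorem summable_fourier_q
    (hs : ∀ (τ : UpperHalfPlane) (z : ℂ),
      HasSum (fun p : ℕ × ℤ => f p.1 p.2 * e2 (p.1 * τ + p.2 * z)) (φ τ z))
    (τ : UpperHalfPlane) (l : ℤ) : Summable fun n => f n l * e2 τ ^ n := by
  have := (hs τ 0).summable.comp_injective (Prod.mk_left_injective l)
  simpa [Function.comp_def, e2_nat_mul] using this

theorem fourier_elliptic
    (hs : ∀ (τ : UpperHalfPlane) (z : ℂ),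
      HasSum (fun p : ℕ × ℤ => f p.1 p.2 * e2 (p.1 * τ + p.2 * z)) (φ τ z))
    (hell : ∀ (τ : UpperHalfPlane) (z : ℂ), φ τ (z + τ) = e2 (-(m * (τ + 2 * z))) * φ τ z)
    (τ : UpperHalfPlane) (l : ℤ) :
    ∑' n, f n (l + 2 * m) * e2 τ ^ n = e2 τ ^ (l + m) * ∑' n, f n l * e2 τ ^ n := by
  set c : ℤ → ℂ := fun l => ∑' n, f n l * e2 τ ^ n with hc
  have h1 : ∀ x : ℝ, HasSum (fun l : ℤ => (c l * e2 τ ^ l) * e2 (l * x)) (φ τ (x + τ)) := by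
    intro x
    have := hasSum_fourier_z hs τ (x + τ)
    simp only [e2_int_mul, e2_add, mul_zpow] at this ⊢
    refine hasSum_of_eq this fun l => ?_
    ring
  have h2 : ∀ x : ℝ, HasSum (fun l : ℤ => (e2 τ ^ (-(m:ℤ)) * c (l + 2 * m)) * e2 (l * x))
      (φ τ (x + τ)) := by
    intro x
    have h3 := (Equiv.addRight (2 * m : ℤ)).hasSum_iff.mpr (hasSum_fourier_z hs τ x)
    have h4 := h3.mul_left (e2 (-(m * (τ + 2 * x))))
    rw [← hell] at h4
    refine hasSum_of_eq h4 fun l => ?_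
    have e1 : e2 (-(m * (τ + 2 * x))) = e2 τ ^ (-(m : ℤ)) * e2 x ^ (-(2 * m : ℤ)) := by
      rw [← e2_int_mul, ← e2_int_mul, ← e2_add]
      push_cast
      ring_nf
    simp only [Function.comp_apply, Equiv.coe_addRight, e1, e2_int_mul]
    rw [zpow_add₀ (e2_ne_zero x), zpow_neg (e2 x)]
    have := zpow_ne_zero (2 * m : ℤ) (e2_ne_zero x)
    field_simp
    simp only [hc]
    ring
  have h5 := eq_zero_of_fourier (e := id) Function.injective_id
    (a := fun l => c l * e2 τ ^ l - e2 τ ^ (-(m:ℤ)) * c (l + 2 * m)) ?_ ?_ l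
  · simp only [sub_eq_zero] at h5
    have h6 : e2 τ ^ (l + m) * c l = e2 τ ^ (m : ℤ) * (c l * e2 τ ^ l) := by
      rw [zpow_add₀ (e2_ne_zero _)]; ring
    rw [h6, h5, ← mul_assoc, ← zpow_add₀ (e2_ne_zero _)]
    simp [hc]
  · have := ((h1 0).sub (h2 0)).summable.norm
    simpa [e2_zero] using this
  · intro x
    have := (h1 x).sub (h2 x)
    simpa [sub_mul] using this

theorem coeff_elliptic
    (hs : ∀ (τ : UpperHalfPlane) (z : ℂ),
      HasSum (fun p : ℕ × ℤ => f p.1 p.2 * e2 (p.1 * τ + p.2 * z)) (φ τ z))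
    (hell : ∀ (τ : UpperHalfPlane) (z : ℂ), φ τ (z + τ) = e2 (-(m * (τ + 2 * z))) * φ τ z)
    (n : ℕ) (l : ℤ) (L : ℕ) (hl : l + m = L) :
    f n (l + 2 * m) = if L ≤ n then f (n - L) l else 0 := by
  rw [← sub_eq_zero]
  refine eq_zero_of_qseries
    (a := fun n => f n (l + 2 * m) - if L ≤ n then f (n - L) l else 0) (fun τ => ?_) n
  have h1 := (summable_fourier_q hs τ (l + 2 * m)).hasSum
  have h2 := ((summable_fourier_q hs τ l).hasSum).mul_left (e2 τ ^ (l + m))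
  rw [← fourier_elliptic hs hell, hl] at h2
  have h3 : HasSum (fun n => (if L ≤ n then f (n - L) l else 0) * e2 τ ^ n)
      (∑' n, f n (l + 2 * m) * e2 τ ^ n) := by
    rw [← (add_left_injective L).hasSum_iff]
    · refine hasSum_of_eq h2 fun n => ?_
      simp only [Function.comp_apply, le_add_iff_nonneg_left, zero_le, if_true,
        Nat.add_sub_cancel, pow_add, zpow_natCast]
      ring
    · intro x hx
      have : ¬ L ≤ x := fun h => hx ⟨x - L, by simp; omega⟩
      simp [this]
  have := h1.sub h3
  simpa [sub_mul] using this

end Elliptic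

end

/-- The coefficient of `ζˡ` in `(ζ + ζ⁻¹ - 2)ⁱ`. -/
def kco : ℕ → ℤ → ℤ
  | 0, l => if l = 0 then 1 else 0
  | i + 1, l => kco i (l - 1) + kco i (l + 1) - 2 * kco i l

theorem kco_eq_zero (i : ℕ) (l : ℤ) (h : (i : ℤ) < l) : kco i l = 0 := by
  induction i generalizing l with
  | zero => simp only [kco, ite_eq_right_iff]; intro h2; simp [h2] at h
  | succ i ih =>
    push_cast at h
    simp [kco, ih (l - 1) (by omega), ih (l + 1) (by omega), ih l (by omega)]

theorem kco_self (i : ℕ) : kco i i = 1 := by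
  induction i with
  | zero => simp [kco]
  | succ i ih =>
    simp [kco, ih, kco_eq_zero i (i + 1 + 1) (by omega), kco_eq_zero i (i + 1) (by omega)]

theorem hasSum_kco (z : ℂ) (i : ℕ) : HasSum (fun l : ℤ => (kco i l : ℂ) * e2 z ^ l) (sv z ^ i) := by
  induction i with
  | zero =>
    have := hasSum_single (f := fun l : ℤ => (kco 0 l : ℂ) * e2 z ^ l) 0 (fun l hl => by
      simp [kco, hl])
    simpa [kco] using this
  | succ i ih =>
    have h1 := ((Equiv.subRight (1 : ℤ)).hasSum_iff.mpr ih).mul_left (e2 z)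
    have h2 := ((Equiv.addRight (1 : ℤ)).hasSum_iff.mpr ih).mul_left (e2 z)⁻¹
    have h3 := (h1.add h2).sub (ih.mul_left 2)
    have h4 : sv z ^ (i + 1) = e2 z * sv z ^ i + (e2 z)⁻¹ * sv z ^ i - 2 * sv z ^ i := by
      rw [pow_succ]
      nth_rewrite 2 [sv]
      rw [e2_neg]; ring
    rw [h4]
    refine hasSum_of_eq h3 fun l => ?_
    have := e2_ne_zero z
    simp only [kco, Function.comp_apply, Equiv.subRight_apply, Equiv.coe_addRight,
      zpow_sub_one₀ this, zpow_add_one₀ this]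
    push_cast
    field_simp

theorem summable_kco {r : ℝ} (hr : 0 < r) (i : ℕ) :
    ∃ κ ≤ (r + r⁻¹ + 2) ^ i, HasSum (fun l : ℤ => ‖(kco i l : ℂ)‖ * r ^ l) κ := by
  induction i with
  | zero =>
    have := hasSum_single (f := fun l : ℤ => ‖(kco 0 l : ℂ)‖ * r ^ l) 0 (fun l hl => by
      simp [kco, hl])
    exact ⟨1, by simp, by simpa [kco] using this⟩
  | succ i ih =>
    obtain ⟨κ, hκ, ih⟩ := ih
    have h1 := ((Equiv.subRight (1 : ℤ)).hasSum_iff.mpr ih).mul_left r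
    have h2 := ((Equiv.addRight (1 : ℤ)).hasSum_iff.mpr ih).mul_left r⁻¹
    have h3 := (h1.add h2).add (ih.mul_left 2)
    have hle : ∀ l : ℤ, ‖(kco (i + 1) l : ℂ)‖ * r ^ l ≤
        r * ((fun l : ℤ => ‖(kco i l : ℂ)‖ * r ^ l) ∘ (Equiv.subRight (1 : ℤ))) l +
        r⁻¹ * ((fun l : ℤ => ‖(kco i l : ℂ)‖ * r ^ l) ∘ (Equiv.addRight (1 : ℤ))) l +
        2 * (‖(kco i l : ℂ)‖ * r ^ l) := by
      intro l
      have e1 : r * ((fun l : ℤ => ‖(kco i l : ℂ)‖ * r ^ l) ∘ (Equiv.subRight (1 : ℤ))) l +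
        r⁻¹ * ((fun l : ℤ => ‖(kco i l : ℂ)‖ * r ^ l) ∘ (Equiv.addRight (1 : ℤ))) l +
        2 * (‖(kco i l : ℂ)‖ * r ^ l) = (‖(kco i (l - 1) : ℂ)‖ + ‖(kco i (l + 1) : ℂ)‖ +
          2 * ‖(kco i l : ℂ)‖) * r ^ l := by
        simp only [Function.comp_apply, Equiv.subRight_apply, Equiv.coe_addRight,
          zpow_sub_one₀ hr.ne', zpow_add_one₀ hr.ne']
        field_simp
      rw [e1]
      have : ‖((kco (i + 1) l : ℤ) : ℂ)‖ ≤ ‖(kco i (l - 1) : ℂ)‖ + ‖(kco i (l + 1) : ℂ)‖ +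
          2 * ‖(kco i l : ℂ)‖ := by
        simp only [kco]
        push_cast
        refine (norm_sub_le _ _).trans (add_le_add (norm_add_le _ _) ?_)
        simp
      gcongr
    have hs : Summable fun l : ℤ => ‖(kco (i + 1) l : ℂ)‖ * r ^ l :=
      Summable.of_nonneg_of_le (fun l => by positivity) hle h3.summable
    refine ⟨_, ?_, hs.hasSum⟩
    refine (hasSum_le hle hs.hasSum h3).trans ?_
    rw [pow_succ]
    have : 0 ≤ r + r⁻¹ + 2 := by positivity
    nlinarith

/-- The coefficient of `ζˡ` in a polynomial in `s = ζ + ζ⁻¹ - 2`. -/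
def lc (l : ℤ) (P : Polynomial ℂ) : ℂ := P.sum fun i a => a * kco i l

theorem lc_add (l : ℤ) (P Q : Polynomial ℂ) : lc l (P + Q) = lc l P + lc l Q :=
  Polynomial.sum_add_index _ _ _ (by simp) (by intros; ring)

theorem lc_monomial (l : ℤ) (i : ℕ) (a : ℂ) : lc l (Polynomial.monomial i a) = a * kco i l :=
  Polynomial.sum_monomial_index _ _ (by simp)

/-- `lc` as an additive map. -/
def lcHom (l : ℤ) : Polynomial ℂ →+ ℂ where
  toFun := lc l
  map_zero' := by simp [lc]
  map_add' := lc_add l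

theorem lc_sub (l : ℤ) (P Q : Polynomial ℂ) : lc l (P - Q) = lc l P - lc l Q :=
  (lcHom l).map_sub P Q

theorem lc_sum (l : ℤ) {ι : Type*} (s : Finset ι) (P : ι → Polynomial ℂ) :
    lc l (∑ i ∈ s, P i) = ∑ i ∈ s, lc l (P i) :=
  map_sum (lcHom l) P s

theorem lc_C_mul (l : ℤ) (a : ℂ) (P : Polynomial ℂ) :
    lc l (Polynomial.C a * P) = a * lc l P := by
  induction P using Polynomial.induction_on' with
  | add p q hp hq => rw [mul_add, lc_add, lc_add, hp, hq]; ring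
  | monomial n b => rw [Polynomial.C_mul_monomial, lc_monomial, lc_monomial]; ring

theorem lc_C (l : ℤ) (a : ℂ) : lc l (Polynomial.C a) = if l = 0 then a else 0 := by
  rw [← Polynomial.monomial_zero_left, lc_monomial]
  simp [kco]

theorem lc_X_add_two_mul (l : ℤ) (P : Polynomial ℂ) :
    lc l ((Polynomial.X + 2) * P) = lc (l - 1) P + lc (l + 1) P := by
  induction P using Polynomial.induction_on' with
  | add p q hp hq => rw [mul_add, lc_add, lc_add, lc_add, hp, hq]; ring
  | monomial n b =>
    have h2 : (2 : Polynomial ℂ) = Polynomial.C 2 := rfl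
    rw [add_mul, lc_add, h2, lc_C_mul, Polynomial.X_mul_monomial]
    simp only [lc_monomial, kco]
    push_cast
    ring

theorem lc_integral (l : ℤ) (P : Polynomial ℤ) :
    ∃ c : ℤ, lc l (P.map (Int.castRingHom ℂ)) = c := by
  induction P using Polynomial.induction_on' with
  | add p q hp hq =>
    obtain ⟨a, ha⟩ := hp
    obtain ⟨b, hb⟩ := hq
    exact ⟨a + b, by rw [Polynomial.map_add, lc_add, ha, hb]; push_cast; ring⟩
  | monomial n b =>
    exact ⟨b * kco n l, by rw [Polynomial.map_monomial, lc_monomial]; simp⟩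

theorem hasSum_lc (z : ℂ) (P : Polynomial ℂ) :
    HasSum (fun l : ℤ => lc l P * e2 z ^ l) (P.eval (sv z)) := by
  induction P using Polynomial.induction_on' with
  | add p q hp hq =>
    rw [Polynomial.eval_add]
    exact hasSum_of_eq (hp.add hq) fun l => by rw [lc_add]; ring
  | monomial n b =>
    rw [Polynomial.eval_monomial]
    exact hasSum_of_eq ((hasSum_kco z n).mul_left b) fun l => by rw [lc_monomial]; ring

theorem summable_lc {r : ℝ} (hr : 0 < r) (P : Polynomial ℂ) :
    ∃ κ ≤ wnorm (r + r⁻¹ + 2) P, HasSum (fun l : ℤ => ‖lc l P‖ * r ^ l) κ := by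
  choose κ hκ hs using summable_kco hr
  have h1 := hasSum_sum (s := P.support) fun i _ => (hs i).mul_left ‖P.coeff i‖
  have hle : ∀ l : ℤ, ‖lc l P‖ * r ^ l ≤
      ∑ i ∈ P.support, ‖P.coeff i‖ * (‖(kco i l : ℂ)‖ * r ^ l) := by
    intro l
    simp only [← mul_assoc]
    rw [← Finset.sum_mul]
    have : ‖lc l P‖ ≤ ∑ i ∈ P.support, ‖P.coeff i‖ * ‖(kco i l : ℂ)‖ := by
      unfold lc Polynomial.sum
      refine (norm_sum_le _ _).trans (le_of_eq ?_)
      simp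
    gcongr
  have h2 : Summable fun l : ℤ => ‖lc l P‖ * r ^ l :=
    Summable.of_nonneg_of_le (fun l => by positivity) hle h1.summable
  refine ⟨_, ?_, h2.hasSum⟩
  refine (hasSum_le hle h2.hasSum h1).trans ?_
  unfold wnorm Polynomial.sum
  exact Finset.sum_le_sum fun i _ => mul_le_mul_of_nonneg_left (hκ i) (norm_nonneg _)

theorem lc_natDegree (P : Polynomial ℂ) : lc P.natDegree P = P.leadingCoeff := by
  unfold lc
  rw [Polynomial.sum_over_range _ (by simp), Finset.sum_range_succ, Finset.sum_eq_zero, kco_self]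
  · simp
  · intro i hi
    rw [kco_eq_zero i _ (by exact_mod_cast Finset.mem_range.mp hi)]
    simp

theorem natDegree_le_of_lc {P : Polynomial ℂ} {m : ℕ} (h : ∀ l : ℤ, (m : ℤ) < l → lc l P = 0) :
    P.natDegree ≤ m := by
  by_contra! hlt
  have h1 := h P.natDegree (by exact_mod_cast hlt)
  rw [lc_natDegree, Polynomial.leadingCoeff_eq_zero] at h1
  simp [h1] at hlt

theorem hasSum_ev_fourier (τ : UpperHalfPlane) (z : ℂ) (F : CR) :
    HasSum (fun p : ℕ × ℤ => lc p.2 (cf p.1 F) * e2 (p.1 * τ + p.2 * z)) (ev τ z F) := by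
  have hr : 0 < ‖e2 z‖ := norm_pos_iff.mpr (e2_ne_zero z)
  have hq := norm_e2_lt_one τ
  have e1 : ∀ p : ℕ × ℤ, lc p.2 (cf p.1 F) * e2 (p.1 * τ + p.2 * z) =
      (lc p.2 (cf p.1 F) * e2 z ^ p.2) * e2 τ ^ p.1 := by
    intro p
    rw [e2_add, e2_nat_mul, e2_int_mul]; ring
  choose κ hκ hs using fun n => summable_lc hr (cf n F)
  have hsum : Summable fun p : ℕ × ℤ => lc p.2 (cf p.1 F) * e2 (p.1 * τ + p.2 * z) := by
    apply Summable.of_norm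
    have hnorm : (fun p : ℕ × ℤ => ‖lc p.2 (cf p.1 F) * e2 (p.1 * τ + p.2 * z)‖) = fun p =>
        (‖lc p.2 (cf p.1 F)‖ * ‖e2 z‖ ^ p.2) * ‖e2 τ‖ ^ p.1 := by
      funext p
      rw [e1, norm_mul, norm_mul, norm_pow, norm_zpow]
    rw [hnorm, summable_prod_of_nonneg (fun _ => by positivity)]
    have hsw : Summable fun n => wnorm (‖e2 z‖ + ‖e2 z‖⁻¹ + 2) (cf n F) * ‖e2 τ‖ ^ n :=
      summable_wnorm F (by positivity) (norm_nonneg _) hq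
    have ht : ∀ n, ∑' l : ℤ, (‖lc l (cf n F)‖ * ‖e2 z‖ ^ l) * ‖e2 τ‖ ^ n = κ n * ‖e2 τ‖ ^ n :=
      fun n => ((hs n).mul_right (‖e2 τ‖ ^ n)).tsum_eq
    have hn : ∀ n, 0 ≤ κ n := fun n => (hs n).nonneg fun l => by positivity
    refine ⟨fun n => (hs n).summable.mul_right (‖e2 τ‖ ^ n), ?_⟩
    simp only [ht]
    exact Summable.of_nonneg_of_le (fun n => mul_nonneg (hn n) (by positivity))
      (fun n => mul_le_mul_of_nonneg_right (hκ n) (by positivity)) hsw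
  have h1 := hsum.hasSum.prod_fiberwise (f := fun p : ℕ × ℤ =>
    lc p.2 (cf p.1 F) * e2 (p.1 * τ + p.2 * z)) (g := fun n => (cf n F).eval (sv z) * e2 τ ^ n)
    (fun n => hasSum_of_eq ((hasSum_lc z (cf n F)).mul_right (e2 τ ^ n)) fun l => e1 (n, l))
  rw [(hasSum_ev τ z F).unique h1]
  exact hsum.hasSum

theorem Jac.natDegree_le {k : ℤ} {m : ℕ} {F : CR} (hF : Jac k m F) : (cf 0 F).natDegree ≤ m := by
  refine natDegree_le_of_lc fun l hl => ?_
  have := coeff_elliptic (f := fun n l => lc l (cf n F)) (fun τ z => hasSum_ev_fourier τ z F)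
    hF.ell 0 (l - 2 * m) (l - m).toNat (by omega)
  rw [if_neg (by omega)] at this
  simpa using this

/-- The polynomial with `vl n (ζ + ζ⁻¹ - 2) = ζⁿ + ζ⁻ⁿ`. -/
def vl : ℕ → Polynomial ℤ
  | 0 => 2
  | 1 => Polynomial.X + 2
  | n + 2 => (Polynomial.X + 2) * vl (n + 1) - vl n

/-- `vl n` with complex coefficients. -/
def vlc (n : ℕ) : Polynomial ℂ := (vl n).map (Int.castRingHom ℂ)

theorem vlc_zero : vlc 0 = 2 := by simp [vlc, vl]

theorem vlc_one : vlc 1 = (Polynomial.X + 2) * 1 := by simp [vlc, vl]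

theorem vlc_add_two (n : ℕ) : vlc (n + 2) = (Polynomial.X + 2) * vlc (n + 1) - vlc n := by
  simp [vlc, vl]

theorem eval_vlc (n : ℕ) (z : ℂ) : (vlc n).eval (sv z) = e2 (n * z) + e2 (-(n * z)) := by
  induction n using Nat.twoStepInduction with
  | zero => simp [vlc_zero, e2_zero]; norm_num
  | one => simp [vlc_one, sv]
  | more n h1 h2 =>
    rw [vlc_add_two, Polynomial.eval_sub, Polynomial.eval_mul, h1, h2]
    simp only [Polynomial.eval_add, Polynomial.eval_X, Polynomial.eval_ofNat, sv, e2_neg,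
      e2_nat_mul, pow_succ]
    have := e2_ne_zero z
    field_simp
    ring

theorem wnorm_vlc_le {ρ : ℝ} (hρ : 0 ≤ ρ) (n : ℕ) : wnorm ρ (vlc n) ≤ 2 * (ρ + 3) ^ n := by
  have hX : wnorm ρ (Polynomial.X + 2) ≤ ρ + 2 := by
    refine (wnorm_add_le hρ _ _).trans ?_
    have : wnorm ρ 2 = 2 := by
      have := wnorm_C ρ 2
      rwa [Complex.norm_ofNat] at this
    rw [wnorm_X, this]
  have h1 : wnorm ρ 1 = 1 := by
    have := wnorm_C ρ 1
    simpa using this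
  induction n using Nat.twoStepInduction with
  | zero =>
    have := wnorm_C ρ 2
    rw [vlc_zero]
    have h2 : (2 : Polynomial ℂ) = Polynomial.C 2 := rfl
    simp [h2, this]
  | one =>
    rw [vlc_one, mul_one]
    linarith
  | more n ih1 ih2 =>
    rw [vlc_add_two, sub_eq_add_neg]
    refine (wnorm_add_le hρ _ _).trans ?_
    rw [wnorm_neg]
    have h3 := (wnorm_mul_le hρ (Polynomial.X + 2) (vlc (n + 1))).trans
      (mul_le_mul hX ih2 (wnorm_nonneg hρ _) (by linarith))
    have h4 : (0:ℝ) ≤ (ρ + 3) ^ n := by positivity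
    simp only [pow_succ] at *
    nlinarith [mul_nonneg hρ h4]

theorem lc_vlc (n : ℕ) (l : ℤ) :
    lc l (vlc n) = (if l = n then 1 else 0) + (if l = -n then 1 else 0) := by
  have h2 : (2 : Polynomial ℂ) = Polynomial.C 2 := rfl
  have h1 : (1 : Polynomial ℂ) = Polynomial.C 1 := rfl
  induction n using Nat.twoStepInduction generalizing l with
  | zero =>
    rw [vlc_zero, h2, lc_C]
    split_ifs
    all_goals simp_all
    norm_num
  | one =>
    rw [vlc_one, lc_X_add_two_mul, h1, lc_C, lc_C]
    congr 1 <;> simp only [sub_eq_zero, Nat.cast_one, eq_neg_iff_add_eq_zero]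
  | more n ih1 ih2 =>
    rw [vlc_add_two, lc_sub, lc_X_add_two_mul, ih1, ih2, ih2]
    have e1 : (l - 1 = ((n + 1 : ℕ) : ℤ)) ↔ l = ((n + 2 : ℕ) : ℤ) := by push_cast; omega
    have e2 : (l - 1 = -((n + 1 : ℕ) : ℤ)) ↔ l = -(n : ℤ) := by push_cast; omega
    have e3 : (l + 1 = ((n + 1 : ℕ) : ℤ)) ↔ l = (n : ℤ) := by push_cast; omega
    have e4 : (l + 1 = -((n + 1 : ℕ) : ℤ)) ↔ l = -((n + 2 : ℕ) : ℤ) := by push_cast; omega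
    simp only [e1, e2, e3, e4]
    ring

theorem fourier_jacobi_unique {f g : ℕ → ℤ → ℂ} {φ : UpperHalfPlane → ℂ → ℂ}
    (hf : ∀ (τ : UpperHalfPlane) (z : ℂ),
      HasSum (fun p : ℕ × ℤ => f p.1 p.2 * e2 (p.1 * τ + p.2 * z)) (φ τ z))
    (hg : ∀ (τ : UpperHalfPlane) (z : ℂ),
      HasSum (fun p : ℕ × ℤ => g p.1 p.2 * e2 (p.1 * τ + p.2 * z)) (φ τ z)) (n : ℕ) (l : ℤ) :
    f n l = g n l := by
  have h : ∀ (τ : UpperHalfPlane) (z : ℂ),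
      HasSum (fun p : ℕ × ℤ => (f p.1 p.2 - g p.1 p.2) * e2 (p.1 * τ + p.2 * z)) 0 := by
    intro τ z
    simpa [sub_mul] using (hf τ z).sub (hg τ z)
  rw [← sub_eq_zero]
  refine eq_zero_of_qseries (a := fun n => f n l - g n l) (fun τ => ?_) n
  have h1 := fun z => hasSum_fourier_z (f := fun n l => f n l - g n l) (φ := fun _ _ => 0) h τ z
  have h2 := eq_zero_of_fourier (e := id) Function.injective_id
    (a := fun l => ∑' n, (f n l - g n l) * e2 τ ^ n)
    (by simpa [e2_zero] using (h1 0).summable.norm)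
    (fun x => by simpa [e2_int_mul] using h1 x) l
  have h3 := (summable_fourier_q (f := fun n l => f n l - g n l) (φ := fun _ _ => 0) h τ l).hasSum
  rwa [h2] at h3

theorem coe_S_smul (τ : UpperHalfPlane) : ((ModularGroup.S • τ : UpperHalfPlane) : ℂ) = -1 / τ := by
  rw [UpperHalfPlane.modular_S_smul]
  simp [neg_div, inv_neg]

theorem exists_e2_eq {w : ℂ} (hw : w ≠ 0) : ∃ z, e2 z = w := by
  refine ⟨Complex.log w / (2 * Real.pi * I), ?_⟩
  have : (2 * (Real.pi : ℂ) * I) ≠ 0 := by simp [Real.pi_ne_zero]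
  rw [e2, mul_div_cancel₀ _ this, Complex.exp_log hw]

theorem norm_e2 (τ : ℂ) : ‖e2 τ‖ = Real.exp (-(2 * Real.pi * τ.im)) := by
  rw [e2, Complex.norm_exp]
  congr 1
  simp

theorem exists_e2_eq_of_lt_one {w : ℂ} (hw : w ≠ 0) (h1 : ‖w‖ < 1) :
    ∃ τ : UpperHalfPlane, e2 τ = w := by
  obtain ⟨z, hz⟩ := exists_e2_eq hw
  refine ⟨⟨z, ?_⟩, hz⟩
  rw [← hz, norm_e2, Real.exp_lt_one_iff] at h1
  have := Real.pi_pos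
  by_contra! h
  nlinarith

/-- The basis polynomial belonging to the orbit `{l, -l}`. -/
def wl (l : ℕ) : Polynomial ℤ := if l = 0 then 1 else vl l

theorem wnorm_wl_le {ρ : ℝ} (hρ : 0 ≤ ρ) (l : ℕ) :
    wnorm ρ ((wl l).map (Int.castRingHom ℂ)) ≤ 2 * (ρ + 3) ^ l := by
  unfold wl
  split_ifs with h
  · have := wnorm_C ρ 1
    simp only [map_one, norm_one] at this
    simp [h, this]
  · exact wnorm_vlc_le hρ l

theorem lc_wl (n : ℕ) (l : ℤ) :
    lc l ((wl n).map (Int.castRingHom ℂ)) = if l.natAbs = n then 1 else 0 := by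
  unfold wl
  split_ifs with h1 h2 h2
  · have := lc_C l 1
    simp only [map_one] at this
    subst h1
    have h3 : l = 0 := by omega
    simpa [h3] using this
  · have := lc_C l 1
    simp only [map_one] at this
    subst h1
    have h3 : l ≠ 0 := by omega
    simp [this, h3]
  · refine (lc_vlc n l).trans ?_
    rcases Int.natAbs_eq l with h | h
    · rw [if_pos (by omega), if_neg (by omega), add_zero]
    · rw [if_neg (by omega), if_pos (by omega), zero_add]
  · refine (lc_vlc n l).trans ?_
    rw [if_neg (by omega), if_neg (by omega), add_zero]

theorem exists_CR_of_weakJacobi {k : ℤ} {m : ℕ} {φ : ℂ → ℂ → ℂ} {f : ℕ → ℤ → ℂ}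
    (hφ : IsWeakJacobiForm (2 * k) m φ f) :
    ∃ F : CR, Jac k m F ∧ (∀ n l, lc l (cf n F) = f n l) ∧
      ∀ n, (∀ l, ∃ c : ℤ, f n l = c) → ∃ P : Polynomial ℤ, P.map (Int.castRingHom ℂ) = cf n F := by
  obtain ⟨-, hmod, hell, hsum⟩ := hφ
  have hs : ∀ (τ : UpperHalfPlane) (z : ℂ),
      HasSum (fun p : ℕ × ℤ => f p.1 p.2 * e2 (p.1 * τ + p.2 * z)) (φ τ z) :=
    fun τ z => hsum τ z τ.im_pos
  have hell' : ∀ (τ : UpperHalfPlane) (z : ℂ),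
      φ τ (z + τ) = e2 (-(m * (τ + 2 * z))) * φ τ z := by
    intro τ z
    have := hell 1 0 τ z τ.im_pos
    simp only [Int.cast_one, one_mul, Int.cast_zero, add_zero, one_pow, mul_one] at this
    rw [this]
    ring_nf
  have heven : ∀ (τ : UpperHalfPlane) (z : ℂ), φ τ (-z) = φ τ z := by
    intro τ z
    have := hmod (-1) 0 0 (-1) (by norm_num) τ z τ.im_pos
    simpa [e2_zero, zpow_mul, div_neg] using this
  have hsymm : ∀ n l, f n (-l) = f n l := by
    refine fourier_jacobi_unique (φ := fun τ => φ τ) (fun τ z => ?_) hs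
    have h1 := (Equiv.prodCongr (Equiv.refl ℕ) (Equiv.neg ℤ)).hasSum_iff.mpr (hs τ (-z))
    rw [heven] at h1
    refine hasSum_of_eq h1 fun p => ?_
    simp
  have hsupp : ∀ (n : ℕ) (l : ℤ), (n : ℤ) + m < l → f n l = 0 := by
    intro n l hl
    have := coeff_elliptic hs hell' n (l - 2 * m) (l - m).toNat (by omega)
    rw [if_neg (by omega)] at this
    simpa using this
  let P : ℕ → Polynomial ℂ := fun n =>
    ∑ l ∈ Finset.range (n + m + 1), Polynomial.C (f n l) * (wl l).map (Int.castRingHom ℂ)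
  have hconv : Conv (PowerSeries.mk P) := by
    intro ρ hρ t ht ht1
    have hρ0 : 0 ≤ ρ := by linarith
    obtain ⟨τ, hτ⟩ := exists_e2_eq_of_lt_one (w := t) (by exact_mod_cast ht.ne')
      (by simpa [abs_of_pos ht] using ht1)
    obtain ⟨z, hz⟩ := exists_e2_eq (w := ((ρ + 3 : ℝ) : ℂ)) (by
      have : ρ + 3 ≠ 0 := by linarith
      exact_mod_cast this)
    have h1 : Summable fun p : ℕ × ℕ => ‖f p.1 p.2‖ * (ρ + 3) ^ p.2 * t ^ p.1 := by
      have := (hs τ z).summable.norm.comp_injective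
        (i := fun p : ℕ × ℕ => (p.1, (p.2 : ℤ))) (fun a b h => by
          simpa [Prod.ext_iff] using h)
      refine this.congr fun p => ?_
      simp only [Function.comp_apply, e2_add, e2_nat_mul, e2_int_mul, hτ, hz, norm_mul, norm_pow,
        zpow_natCast, Complex.norm_real, Real.norm_eq_abs, abs_of_pos ht,
        abs_of_pos (show (0:ℝ) < ρ + 3 by linarith)]
      ring
    have h2 := (summable_prod_of_nonneg (fun p => by positivity)).mp h1
    refine Summable.of_nonneg_of_le
      (fun n => mul_nonneg (wnorm_nonneg hρ0 _) (by positivity)) (fun n => ?_) (h2.2.mul_left 2)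
    rw [PowerSeries.coeff_mk]
    have h3 := (h2.1 n).sum_le_tsum (Finset.range (n + m + 1)) fun l _ => by positivity
    refine le_trans ?_ (mul_le_mul_of_nonneg_left h3 zero_le_two)
    refine (mul_le_mul_of_nonneg_right (wnorm_sum_le hρ0 _ _) (by positivity)).trans ?_
    rw [Finset.sum_mul, Finset.mul_sum]
    refine Finset.sum_le_sum fun l _ => ?_
    have h4 := (wnorm_mul_le hρ0 (Polynomial.C (f n l)) ((wl l).map (Int.castRingHom ℂ))).trans
      (mul_le_mul_of_nonneg_left (wnorm_wl_le hρ0 l) (wnorm_nonneg hρ0 _))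
    rw [wnorm_C] at h4
    refine (mul_le_mul_of_nonneg_right h4 (by positivity)).trans (le_of_eq ?_)
    ring
  let F : CR := ⟨PowerSeries.mk P, hconv⟩
  have hcf : ∀ n, cf n F = P n := fun n => PowerSeries.coeff_mk n P
  have hlc : ∀ n l, lc l (cf n F) = f n l := by
    intro n l
    rw [hcf, lc_sum]
    simp only [lc_C_mul, lc_wl, mul_ite, mul_one, mul_zero]
    rw [Finset.sum_ite_eq]
    have h1 : f n (l.natAbs : ℤ) = f n l := by
      rcases Int.natAbs_eq l with h | h
      · rw [← h]
      · nth_rewrite 2 [h]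
        rw [hsymm]
    split_ifs with h
    · exact h1
    · rw [← h1, hsupp]
      simp at h
      omega
  have hev : ∀ τ z, ev τ z F = φ τ z := fun τ z =>
    (hasSum_of_eq (hasSum_ev_fourier τ z F) fun p => by rw [hlc]).unique (hs τ z)
  refine ⟨F, ⟨fun τ z => ?_, fun τ z => ?_⟩, hlc, fun n hn => ?_⟩
  · rw [hev, hev]
    have := hmod 0 (-1) 1 0 (by norm_num) τ z τ.im_pos
    rw [coe_S_smul]
    simpa [neg_div] using this
  · rw [hev, hev, hell']
  · choose c hc using hn
    refine ⟨∑ l ∈ Finset.range (n + m + 1), Polynomial.C (c l) * wl l, ?_⟩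
    rw [hcf, Polynomial.map_sum]
    refine Finset.sum_congr rfl fun l _ => ?_
    simp [hc]

theorem exists_sv_eq (s : ℂ) : ∃ z, sv z = s := by
  obtain ⟨d, hd⟩ := IsAlgClosed.exists_pow_nat_eq ((s + 2) ^ 2 - 4) (n := 2) (by norm_num)
  set w := ((s + 2) + d) / 2 with hw
  have h1 : w ^ 2 - (s + 2) * w + 1 = 0 := by
    rw [hw]; linear_combination hd / 4
  have h0 : w ≠ 0 := by
    rintro h; simp [h] at h1
  obtain ⟨z, hz⟩ := exists_e2_eq h0
  refine ⟨z, ?_⟩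
  rw [sv, e2_neg, hz]
  field_simp
  linear_combination h1

theorem CR.ext_ev {F G : CR} (h : ∀ τ z, ev τ z F = ev τ z G) : F = G := by
  refine CR.ext_cf fun n => ?_
  refine Polynomial.funext fun s => ?_
  obtain ⟨z, rfl⟩ := exists_sv_eq s
  have := eq_zero_of_qseries (a := fun n => (cf n F).eval (sv z) - (cf n G).eval (sv z))
    (fun τ => ?_) n
  · exact sub_eq_zero.mp this
  · have := (hasSum_ev τ z F).sub (hasSum_ev τ z G)
    simpa [sub_mul, h τ z] using this

/-- A power series in `q` alone. -/
def qs (a : ℕ → ℂ) (h : ∀ t : ℝ, 0 < t → t < 1 → Summable fun n => ‖a n‖ * t ^ n) : CR :=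
  ⟨PowerSeries.mk fun n => Polynomial.C (a n), fun ρ _ t ht ht1 => by
    simpa [wnorm_C] using h t ht ht1⟩

@[simp] theorem cf_qs (a : ℕ → ℂ) (h) (n : ℕ) : cf n (qs a h) = Polynomial.C (a n) := by
  simp [cf, qs]

theorem hasSum_ev_qs (a : ℕ → ℂ) (h) (τ : UpperHalfPlane) (z : ℂ) :
    HasSum (fun n => a n * e2 τ ^ n) (ev τ z (qs a h)) := by
  simpa using hasSum_ev τ z (qs a h)

theorem qs_mem_ZR {a : ℕ → ℂ} (h) (ha : ∀ n, ∃ c : ℤ, a n = c) : qs a h ∈ ZR := by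
  rw [mem_ZR_iff]
  intro n
  obtain ⟨c, hc⟩ := ha n
  exact ⟨Polynomial.C c, by simp [hc]⟩

theorem summable_sigma (k : ℕ) (t : ℝ) (ht : 0 < t) (ht1 : t < 1) :
    Summable fun n => ‖((ArithmeticFunction.sigma k n : ℕ) : ℂ)‖ * t ^ n := by
  refine Summable.of_nonneg_of_le (fun _ => by positivity) (fun n => ?_)
    (summable_pow_mul_geometric_of_norm_lt_one (k + 1) (r := t) (by
      rwa [Real.norm_of_nonneg ht.le]))
  gcongr
  rw [Complex.norm_natCast]
  exact_mod_cast ArithmeticFunction.sigma_le_pow_succ k n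

/-- The generating series of the divisor sums `σₖ`. -/
def sg (k : ℕ) : CR := qs (fun n => (ArithmeticFunction.sigma k n : ℕ)) (summable_sigma k)

theorem sg_mem_ZR (k : ℕ) : sg k ∈ ZR := qs_mem_ZR _ fun _ => ⟨_, (Int.cast_natCast _).symm⟩

theorem twelve_dvd_sigma (n : ℕ) :
    12 ∣ 5 * ArithmeticFunction.sigma 3 n + 7 * ArithmeticFunction.sigma 5 n := by
  rw [ArithmeticFunction.sigma_apply, ArithmeticFunction.sigma_apply, Finset.mul_sum,
    Finset.mul_sum, ← Finset.sum_add_distrib]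
  refine Finset.dvd_sum fun d _ => ?_
  rw [← CharP.cast_eq_zero_iff (ZMod 12) 12]
  push_cast
  generalize (d : ZMod 12) = x
  revert x
  decide

/-- The series with `12 sb = 5 σ₃ + 7 σ₅`. -/
def sb : CR := qs (fun n => ((5 * ArithmeticFunction.sigma 3 n + 7 * ArithmeticFunction.sigma 5 n) / 12 : ℕ))
  fun t ht ht1 => by
    refine Summable.of_nonneg_of_le (fun _ => by positivity) (fun n => ?_)
      (((summable_sigma 3 t ht ht1).mul_left 5).add ((summable_sigma 5 t ht ht1).mul_left 7))
    rw [← mul_assoc, ← mul_assoc, ← add_mul]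
    gcongr
    simp only [Complex.norm_natCast]
    exact_mod_cast Nat.div_le_self _ _

theorem sb_mem_ZR : sb ∈ ZR := qs_mem_ZR _ fun _ => ⟨_, (Int.cast_natCast _).symm⟩

theorem twelve_sb : 12 * sb = 5 * sg 3 + 7 * sg 5 := by
  refine CR.ext_ev fun τ z => ?_
  simp only [map_mul, map_add, map_ofNat]
  refine ((hasSum_ev_qs _ _ τ z).mul_left 12).unique (hasSum_of_eq
    (((hasSum_ev_qs _ _ τ z).mul_left 5).add ((hasSum_ev_qs _ _ τ z).mul_left 7)) fun n => ?_)
  rw [← mul_assoc, ← mul_assoc, ← mul_assoc, ← add_mul]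
  congr 1
  have := Nat.mul_div_cancel' (twelve_dvd_sigma n)
  exact_mod_cast this

/-- The Eisenstein series of weight `4`. -/
def E4 : CR := 1 + 240 * sg 3

/-- The Eisenstein series of weight `6`. -/
def E6 : CR := 1 - 504 * sg 5

theorem E4_mem_ZR : E4 ∈ ZR :=
  add_mem (one_mem _) (mul_mem (ofNat_mem _ _) (sg_mem_ZR 3))

theorem E6_mem_ZR : E6 ∈ ZR :=
  sub_mem (one_mem _) (mul_mem (ofNat_mem _ _) (sg_mem_ZR 5))

theorem qParam_one (τ : ℂ) : Function.Periodic.qParam 1 τ = e2 τ := by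
  simp [Function.Periodic.qParam, e2]

theorem hasSum_modularForm {k : ℤ} (f : ModularForm (Matrix.SpecialLinearGroup.mapGL (R := ℤ) ℝ).range k) (τ : UpperHalfPlane) :
    HasSum (fun n => (UpperHalfPlane.qExpansion 1 f).coeff n * e2 τ ^ n) (f τ) := by
  have := ModularForm.hasSum_qExpansion (f := f) one_pos one_mem_strictPeriods_SL τ
  simpa [qParam_one] using this

theorem hasSum_one_add (τ : UpperHalfPlane) (z c : ℂ) (k : ℕ) :
    HasSum (fun n => (if n = 0 then 1 else c * (ArithmeticFunction.sigma k n : ℕ)) * e2 τ ^ n)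
      (1 + c * ev τ z (sg k)) := by
  have h1 := ((hasSum_ev_qs _ (summable_sigma k) τ z).mul_left c).add
    (hasSum_ite_eq (0 : ℕ) (1 : ℂ))
  rw [add_comm]
  refine hasSum_of_eq h1 fun n => ?_
  by_cases hn : n = 0
  · simp [hn]
  · simp [hn, mul_assoc]

theorem ev_E4 (τ : UpperHalfPlane) (z : ℂ) : ev τ z E4 = ModularForm.E₄ τ := by
  refine (?_ : HasSum _ _).unique (hasSum_modularForm ModularForm.E₄ τ)
  have h1 := hasSum_one_add τ z 240 3
  rw [E4, map_add, map_one, map_mul, map_ofNat]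
  refine hasSum_of_eq h1 fun n => ?_
  rw [EisensteinSeries.E_qExpansion_coeff _ ⟨2, rfl⟩]
  norm_num [show bernoulli 4 = -1 / 30 by decide +kernel]

theorem ev_E6 (τ : UpperHalfPlane) (z : ℂ) : ev τ z E6 = ModularForm.E₆ τ := by
  refine (?_ : HasSum _ _).unique (hasSum_modularForm ModularForm.E₆ τ)
  have h1 := hasSum_one_add τ z (-504) 5
  rw [E6, map_sub, map_one, map_mul, map_ofNat, sub_eq_add_neg, ← neg_mul]
  refine hasSum_of_eq h1 fun n => ?_
  rw [EisensteinSeries.E_qExpansion_coeff _ ⟨3, rfl⟩]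
  norm_num [show bernoulli 6 = 1 / 42 by decide +kernel]

theorem modularForm_S {k : ℤ} (f : ModularForm (Matrix.SpecialLinearGroup.mapGL (R := ℤ) ℝ).range k)
    (τ : UpperHalfPlane) : f (ModularGroup.S • τ) = (τ : ℂ) ^ k * f τ := by
  have h : (f : UpperHalfPlane → ℂ) ∣[k] ModularGroup.S = f :=
    SlashInvariantForm.slash_action_eqn f _ ⟨ModularGroup.S, rfl⟩
  have h1 := congrFun h τ
  rw [SlashInvariantForm.slash_S_apply, ← UpperHalfPlane.modular_S_smul] at h1
  rw [← h1, mul_comm, mul_assoc, ← zpow_add₀ τ.ne_zero]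
  simp

theorem Jac_E4 : Jac 2 0 E4 where
  mod τ z := by
    rw [ev_E4, ev_E4, modularForm_S]
    simp [e2_zero]
  ell τ z := by simp [ev_E4, e2_zero]

theorem Jac_E6 : Jac 3 0 E6 where
  mod τ z := by
    rw [ev_E6, ev_E6, modularForm_S]
    simp [e2_zero]
  ell τ z := by simp [ev_E6, e2_zero]

theorem exists_DD : ∃ G : CR, qX * (1728 * G) = E4 ^ 3 - E6 ^ 2 ∧ G ∈ ZR ∧ cf 0 G = 1 := by
  obtain ⟨e, he⟩ := exists_eq_qX_mul (F := sg 3) (by simp [sg])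
  obtain ⟨f, hf⟩ := exists_eq_qX_mul (F := sg 5) (by simp [sg])
  obtain ⟨b, hb⟩ := exists_eq_qX_mul (F := sb) (by simp [sb])
  have hb0 : cf 0 b = 1 := by
    rw [← cf_succ_qX_mul, ← hb]
    simp [sb]
  refine ⟨b + qX * (100 * e ^ 2 + 8000 * qX * e ^ 3 - 147 * f ^ 2), ?_, ?_, ?_⟩
  · rw [E4, E6]
    have := twelve_sb
    rw [he, hf, hb] at *
    linear_combination 144 * this
  · have h1 : e ∈ ZR := mem_ZR_of_qX_mul (he ▸ sg_mem_ZR 3)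
    have h2 : f ∈ ZR := mem_ZR_of_qX_mul (hf ▸ sg_mem_ZR 5)
    have h3 : b ∈ ZR := mem_ZR_of_qX_mul (hb ▸ sb_mem_ZR)
    exact add_mem h3 (mul_mem qX_mem_ZR (sub_mem (add_mem (mul_mem (ofNat_mem _ _) (pow_mem h1 _))
      (mul_mem (mul_mem (ofNat_mem _ _) qX_mem_ZR) (pow_mem h1 _)))
      (mul_mem (ofNat_mem _ _) (pow_mem h2 _))))
  · simp [hb0]

/-- The discriminant divided by `q`. -/
def DD : CR := exists_DD.choose

theorem DD_spec : qX * (1728 * DD) = E4 ^ 3 - E6 ^ 2 := exists_DD.choose_spec.1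

theorem DD_mem_ZR : DD ∈ ZR := exists_DD.choose_spec.2.1

theorem cf_zero_DD : cf 0 DD = 1 := exists_DD.choose_spec.2.2

theorem ev_qX_mul_DD (τ : UpperHalfPlane) (z : ℂ) :
    ev τ z (qX * DD) = ModularForm.discriminant τ := by
  have := congrArg (ev τ z) DD_spec
  rw [ModularForm.discriminant_eq_E₄_cube_sub_E₆_sq, ← ev_E4 τ z, ← ev_E6 τ z]
  simp only [map_mul, map_sub, map_pow, map_ofNat] at this ⊢
  linear_combination this / 1728

theorem ev_DD (τ : UpperHalfPlane) (z : ℂ) :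
    ev τ z DD = ModularForm.discriminant τ / e2 τ := by
  rw [eq_div_iff (e2_ne_zero _), ← ev_qX_mul_DD τ z, map_mul, ev_qX, mul_comm]

theorem ev_qX_mul_DD_ne_zero (τ : UpperHalfPlane) (z : ℂ) : ev τ z (qX * DD) ≠ 0 := by
  rw [ev_qX_mul_DD]; exact ModularForm.discriminant_ne_zero τ

theorem Jac_qX_mul_DD : Jac 6 0 (qX * DD) := by
  refine Jac.of_int_mul (n := 1728) (by norm_num) ?_
  have h : ((1728 : ℤ) : CR) * (qX * DD) = E4 ^ 3 - E6 ^ 2 := by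
    rw [← DD_spec]; push_cast; ring
  rw [h]
  exact ((Jac_E4.pow 3).cast (k' := 6) (m' := 0) (by norm_num) (by norm_num)).sub
    ((Jac_E6.pow 2).cast (by norm_num) (by norm_num))

theorem sv_zero : sv 0 = 0 := by simp [sv, e2_zero]; norm_num

theorem differentiableOn_series (F : CR) :
    DifferentiableOn ℂ (fun w => ∑' n, (cf n F).eval 0 * w ^ n) (Metric.ball 0 1) := by
  intro w hw
  obtain ⟨r, hr, hr1⟩ := exists_between (mem_ball_zero_iff.mp hw)
  have hr0 : 0 ≤ r := (norm_nonneg _).trans hr.le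
  have h1 : Summable fun n => ‖(cf n F).eval 0‖ * r ^ n := by
    have := summable_norm_eval F (q := r) (by simpa [abs_of_nonneg hr0] using hr1) 0
    simpa [abs_of_nonneg hr0] using this
  have h2 := differentiableOn_tsum_of_summable_norm (F := fun n (w : ℂ) => (cf n F).eval 0 * w ^ n)
    (U := Metric.ball (0 : ℂ) r) h1 (fun n => by fun_prop) Metric.isOpen_ball
    (fun n w hw => by
      rw [norm_mul, norm_pow]
      have := (mem_ball_zero_iff.mp hw).le
      gcongr)
  exact (h2.differentiableAt (Metric.isOpen_ball.mem_nhds (by simpa using hr))).differentiableWithinAt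

theorem exists_DI : ∃ G : CR, G * DD = 1 := by
  set g : ℂ → ℂ := fun w => ∑' n, (cf n DD).eval 0 * w ^ n with hg
  have hgτ : ∀ (τ : UpperHalfPlane) z, g (e2 τ) = ev τ z DD := by
    intro τ z
    have := (hasSum_ev τ 0 DD).tsum_eq
    rw [sv_zero, ev_DD, ← ev_DD τ z] at this
    exact this
  have h0 : ∀ w ∈ Metric.ball (0 : ℂ) 1, g w ≠ 0 := by
    intro w hw
    by_cases hw0 : w = 0
    · rw [hw0, hg]
      simp only
      rw [tsum_eq_single 0 (by intro n hn; simp [hn])]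
      simp [cf_zero_DD]
    · obtain ⟨τ, rfl⟩ := exists_e2_eq_of_lt_one hw0 (by simpa using hw)
      rw [hgτ τ 0]
      have := ev_qX_mul_DD_ne_zero τ 0
      rw [map_mul] at this
      exact right_ne_zero_of_mul this
  have h1 : DifferentiableOn ℂ (fun w => (g w)⁻¹) (Metric.ball 0 1) :=
    (differentiableOn_series DD).inv h0
  set c : ℕ → ℂ := fun n => ((n.factorial : ℂ)⁻¹ * iteratedDeriv n (fun w => (g w)⁻¹) 0)
  have h2 : ∀ w ∈ Metric.ball (0 : ℂ) 1, HasSum (fun n => c n * w ^ n) (g w)⁻¹ := by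
    intro w hw
    have := Complex.hasSum_taylorSeries_on_ball h1 hw
    simp only [sub_zero, smul_eq_mul] at this
    refine hasSum_of_eq this fun n => ?_
    simp only [c]; ring
  have h4 : ∀ t : ℝ, 0 < t → t < 1 → Summable fun n => ‖c n‖ * t ^ n := by
    intro t ht ht1
    have := (h2 t (by simpa [abs_of_pos ht] using ht1)).summable.norm
    simpa [abs_of_pos ht] using this
  refine ⟨qs c h4, CR.ext_ev fun τ z => ?_⟩
  · have hb : e2 τ ∈ Metric.ball (0 : ℂ) 1 := by simpa using norm_e2_lt_one τ
    have h3 := (hasSum_ev_qs c h4 τ z).unique (h2 _ hb)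
    rw [map_mul, map_one, h3, ← hgτ τ z, inv_mul_cancel₀ (h0 _ hb)]

/-- The inverse of `DD`. -/
def DI : CR := exists_DI.choose

theorem DI_mul_DD : DI * DD = 1 := exists_DI.choose_spec

theorem cf_zero_DI : cf 0 DI = 1 := by
  have := congrArg (cf 0) DI_mul_DD
  simpa [cf_zero_DD] using this

theorem DI_mem_ZR : DI ∈ ZR := by
  obtain ⟨G, hG⟩ := DD_mem_ZR
  have hG0 : PowerSeries.constantCoeff G = 1 := by
    have h1 : (PowerSeries.constantCoeff G).map (Int.castRingHom ℂ) = 1 := by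
      rw [← cf_zero_DD]
      have := congrArg (PowerSeries.coeff 0) hG
      simpa [cf] using this
    apply Polynomial.map_injective (Int.castRingHom ℂ) Int.cast_injective
    rw [h1, Polynomial.map_one]
  obtain ⟨H, hH⟩ := (PowerSeries.isUnit_iff_constantCoeff.mpr (hG0 ▸ isUnit_one)).exists_right_inv
  refine ⟨H, ?_⟩
  have h1 := congrArg (PowerSeries.map (Polynomial.mapRingHom (Int.castRingHom ℂ))) hH
  rw [map_mul, map_one, hG] at h1
  have h2 : (DI : PowerSeries (Polynomial ℂ)) * (DD : PowerSeries (Polynomial ℂ)) = 1 :=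
    congrArg Subtype.val DI_mul_DD
  have h3 : (CR.subtype DD : PowerSeries (Polynomial ℂ)) = DD := rfl
  rw [h3] at h1
  change _ = (DI : PowerSeries (Polynomial ℂ))
  calc _ = (DI : PowerSeries (Polynomial ℂ)) * DD * _ := by rw [h2, one_mul]
    _ = _ := by rw [mul_assoc]; exact (congrArg _ h1).trans (mul_one _)

/-- The discriminant. -/
def DT : CR := qX * DD

theorem ev_DT_ne_zero (τ : UpperHalfPlane) (z : ℂ) : ev τ z DT ≠ 0 := ev_qX_mul_DD_ne_zero τ z

theorem Jac_DT : Jac 6 0 DT := Jac_qX_mul_DD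

theorem Jac.of_mul_DT {k : ℤ} {m : ℕ} {F : CR} (h : Jac k m (F * DT)) :
    Jac (k - 6) m F where
  mod τ z := by
    have h1 := h.mod τ z
    have h2 := Jac_DT.mod τ z
    have h3 := ev_DT_ne_zero τ z
    have h4 := zpow_ne_zero (2 * 6) τ.ne_zero
    rw [map_mul, map_mul, h2] at h1
    simp only [Nat.cast_zero, zero_mul, e2_zero, mul_one] at h1
    have h5 : (τ : ℂ) ^ (2 * k) = (τ : ℂ) ^ (2 * (k - 6)) * (τ : ℂ) ^ (2 * 6 : ℤ) := by
      rw [← zpow_add₀ τ.ne_zero]; ring_nf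
    rw [h5] at h1
    apply mul_right_cancel₀ (mul_ne_zero h4 h3)
    rw [h1]; ring
  ell τ z := by
    have h1 := h.ell τ z
    have h2 := Jac_DT.ell τ z
    have h3 := ev_DT_ne_zero τ z
    rw [map_mul, map_mul, h2] at h1
    simp only [Nat.cast_zero, zero_mul, neg_zero, e2_zero, one_mul] at h1
    apply mul_right_cancel₀ h3
    rw [h1]; ring

theorem Jac.mul_DI {k : ℤ} {m : ℕ} {F : CR} (h : Jac k m (qX * F)) : Jac (k - 6) m (F * DI) := by
  apply Jac.of_mul_DT
  have : F * DI * DT = qX * F := by rw [DT]; linear_combination qX * F * DI_mul_DD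
  rwa [this]

theorem wnorm_le_wnorm_X_mul {ρ : ℝ} (hρ : 1 ≤ ρ) (P : Polynomial ℂ) :
    wnorm ρ P ≤ wnorm ρ (Polynomial.X * P) := by
  have h0 : 0 ≤ ρ := zero_le_one.trans hρ
  have h1 := hasSum_wnorm ρ (Polynomial.X * P)
  have h2 := (summable_nat_add_iff 1).mpr h1.summable
  have h3 := h1.summable.sum_add_tsum_nat_add 1
  rw [h1.tsum_eq] at h3
  have h4 := Summable.tsum_le_tsum (f := fun i => ‖P.coeff i‖ * ρ ^ i) (fun i => ?_)
    (hasSum_wnorm ρ P).summable h2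
  · rw [(hasSum_wnorm ρ P).tsum_eq] at h4
    simp only [Finset.sum_range_one] at h3
    have h5 : 0 ≤ ‖(Polynomial.X * P).coeff 0‖ * ρ ^ 0 := by positivity
    linarith
  · rw [Polynomial.coeff_X_mul]
    have : ρ ^ i ≤ ρ ^ (i + 1) := pow_le_pow_right₀ hρ (by omega)
    gcongr

/-- The variable `s` as a convergent series. -/
def sX : CR := ⟨PowerSeries.C Polynomial.X, by
  intro ρ hρ t ht ht1
  refine summable_of_ne_finset_zero (s := {0}) fun n hn => ?_
  have : n ≠ 0 := by simpa using hn
  simp [PowerSeries.coeff_C, this, wnorm_zero]⟩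

theorem cf_sX_mul (n : ℕ) (F : CR) : cf n (sX * F) = Polynomial.X * cf n F :=
  PowerSeries.coeff_C_mul _ _ _

theorem ev_sX (τ : UpperHalfPlane) (z : ℂ) : ev τ z sX = sv z := by
  refine (hasSum_ev τ z sX).unique ?_
  have := hasSum_single (f := fun n => (cf n sX).eval (sv z) * e2 τ ^ n) 0 (fun n hn => by
    simp [cf, sX, PowerSeries.coeff_C, hn])
  simpa [cf, sX] using this

theorem exists_eq_sX_mul {F : CR} (h : ∀ n, (cf n F).coeff 0 = 0) : ∃ G : CR, F = sX * G := by
  choose P hP using fun n => Polynomial.X_dvd_iff.mpr (h n)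
  refine ⟨⟨PowerSeries.mk P, fun ρ hρ t ht ht1 => ?_⟩, CR.ext_cf fun n => ?_⟩
  · refine Summable.of_nonneg_of_le (fun n => ?_) (fun n => ?_) (F.2 ρ hρ t ht ht1)
    · have := wnorm_nonneg (zero_le_one.trans hρ) (PowerSeries.coeff n (PowerSeries.mk P))
      positivity
    · have h1 := wnorm_le_wnorm_X_mul hρ (P n)
      rw [← hP n] at h1
      rw [PowerSeries.coeff_mk]
      exact mul_le_mul_of_nonneg_right h1 (by positivity)
  · rw [cf_sX_mul, hP n]
    simp [cf]

theorem exists_eq_sX_pow_mul {F : CR} (r : ℕ) (h : ∀ n, ∀ i < r, (cf n F).coeff i = 0) :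
    ∃ G : CR, F = sX ^ r * G ∧ ∀ n, (cf n G).coeff 0 = (cf n F).coeff r := by
  have key : ∀ (r n : ℕ) (G : CR), (cf n (sX ^ r * G)).coeff r = (cf n G).coeff 0 := by
    intro r n G
    induction r with
    | zero => simp
    | succ r ih => rw [pow_succ', mul_assoc, cf_sX_mul, Polynomial.coeff_X_mul, ih]
  suffices ∃ G : CR, F = sX ^ r * G by
    obtain ⟨G, hG⟩ := this
    exact ⟨G, hG, fun n => by rw [hG, key]⟩
  induction r with
  | zero => exact ⟨F, by simp⟩
  | succ r ih =>
    obtain ⟨G, rfl⟩ := ih fun n i hi => h n i (by omega)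
    obtain ⟨H, rfl⟩ := exists_eq_sX_mul (F := G) fun n => by rw [← key r]; exact h n r (by omega)
    exact ⟨H, by ring⟩

theorem tendsto_sv (c : ℂ) :
    Filter.Tendsto (fun z : ℂ => (z⁻¹) ^ 2 * sv (c * z)) (𝓝[≠] 0)
      (𝓝 ((2 * (Real.pi : ℂ) * Complex.I * c) ^ 2)) := by
  have h1 : HasDerivAt (fun z => e2 (c * z)) (2 * (Real.pi : ℂ) * Complex.I * c) 0 := by
    have h := ((hasDerivAt_id (0 : ℂ)).const_mul (2 * (Real.pi : ℂ) * Complex.I * c)).cexp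
    simp only [id, mul_zero, Complex.exp_zero, mul_one, one_mul] at h
    refine h.congr_of_eventuallyEq (Filter.Eventually.of_forall fun z => ?_)
    simp [e2, mul_assoc]
  have h2 := h1.tendsto_slope_zero
  have h3 : Filter.Tendsto (fun z : ℂ => e2 (-(c * z))) (𝓝[≠] 0) (𝓝 1) := by
    have : Continuous fun z : ℂ => e2 (-(c * z)) := by have := continuous_e2; fun_prop
    have h := this.tendsto 0
    simp only [mul_zero, neg_zero, e2_zero] at h
    exact h.mono_left nhdsWithin_le_nhds
  have h4 := (h2.pow 2).mul h3
  rw [mul_one] at h4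
  refine h4.congr fun z => ?_
  simp only [zero_add, mul_zero, e2_zero, smul_eq_mul, sv, e2_neg]
  have := e2_ne_zero (c * z)
  generalize e2 (c * z) = w at *
  generalize z⁻¹ = y
  field_simp
  ring

theorem tendsto_ev (τ : UpperHalfPlane) (c : ℂ) (G : CR) :
    Filter.Tendsto (fun z : ℂ => ev τ (c * z) G) (𝓝[≠] 0) (𝓝 (ev τ 0 G)) := by
  have hq := norm_e2_lt_one τ
  have h1 : ContinuousOn (fun s : ℂ => ∑' n, (cf n G).eval s * e2 τ ^ n) (Metric.ball 0 1) := by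
    refine continuousOn_tsum (u := fun n => wnorm 1 (cf n G) * ‖e2 τ‖ ^ n) (fun n => ?_)
      (summable_wnorm G zero_le_one (norm_nonneg _) hq) fun n s hs => ?_
    · exact ((cf n G).continuous.mul continuous_const).continuousOn
    · rw [norm_mul, norm_pow]
      have := norm_eval_le_wnorm (mem_ball_zero_iff.mp hs).le (cf n G)
      gcongr
  have h2 : Filter.Tendsto (fun z : ℂ => sv (c * z)) (𝓝[≠] 0) (𝓝 0) := by
    have : Continuous fun z : ℂ => sv (c * z) := by
      have := continuous_e2; unfold sv; fun_prop
    have h := this.tendsto 0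
    simp only [mul_zero, sv_zero] at h
    exact h.mono_left nhdsWithin_le_nhds
  have h3 := ((h1.continuousAt (Metric.isOpen_ball.mem_nhds (by simp))).tendsto (x := 0)).comp h2
  have h4 := (hasSum_ev τ 0 G).tsum_eq
  rw [sv_zero] at h4
  rw [h4] at h3
  exact h3.congr fun z => (hasSum_ev τ (c * z) G).tsum_eq

theorem lead_S {k : ℤ} {m r : ℕ} {G : CR} (h : Jac k m (sX ^ r * G)) (τ : UpperHalfPlane) :
    ev (ModularGroup.S • τ) 0 G = (τ : ℂ) ^ (2 * k + 2 * r) * ev τ 0 G := by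
  have h1 : Filter.Tendsto (fun z : ℂ => ((z⁻¹) ^ 2 * sv ((τ : ℂ)⁻¹ * z)) ^ r *
      ev (ModularGroup.S • τ) ((τ : ℂ)⁻¹ * z) G) (𝓝[≠] 0)
      (𝓝 (((2 * (Real.pi : ℂ) * Complex.I * (τ : ℂ)⁻¹) ^ 2) ^ r * ev (ModularGroup.S • τ) 0 G)) :=
    ((tendsto_sv _).pow r).mul (tendsto_ev _ _ G)
  have h2 : Filter.Tendsto (fun z : ℂ => (τ : ℂ) ^ (2 * k) * e2 (m * (z ^ 2 / τ)) *
      (((z⁻¹) ^ 2 * sv (1 * z)) ^ r * ev τ (1 * z) G)) (𝓝[≠] 0)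
      (𝓝 ((τ : ℂ) ^ (2 * k) * 1 * (((2 * (Real.pi : ℂ) * Complex.I * 1) ^ 2) ^ r * ev τ 0 G))) := by
    refine Filter.Tendsto.mul (Filter.Tendsto.mul tendsto_const_nhds ?_)
      (((tendsto_sv _).pow r).mul (tendsto_ev _ _ G))
    have : Continuous fun z : ℂ => e2 (m * (z ^ 2 / τ)) := by have := continuous_e2; fun_prop
    have h := this.tendsto 0
    simp only [ne_eq, OfNat.ofNat_ne_zero, not_false_eq_true, zero_pow, zero_div, mul_zero,
      e2_zero] at h
    exact h.mono_left nhdsWithin_le_nhds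
  have h3 := tendsto_nhds_unique (h1.congr fun z => ?_) h2
  · have hπ : (2 * (Real.pi : ℂ) * Complex.I) ≠ 0 := by simp [Real.pi_ne_zero]
    generalize 2 * (Real.pi : ℂ) * Complex.I = p at *
    have hp := pow_ne_zero (2 * r) hπ
    have hτ := τ.ne_zero
    rw [zpow_add₀ hτ]
    have e1 : (τ : ℂ) ^ (2 * (r : ℤ)) = (τ : ℂ) ^ (2 * r) := by norm_cast
    rw [e1]
    have e5 : ((p * (τ : ℂ)⁻¹) ^ 2) ^ r = p ^ (2 * r) * ((τ : ℂ) ^ (2 * r))⁻¹ := by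
      rw [← pow_mul, mul_pow, inv_pow]
    rw [e5, mul_one, mul_one, ← pow_mul] at h3
    apply mul_left_cancel₀ hp
    have h4 := pow_ne_zero (2 * r) hτ
    generalize (τ : ℂ) ^ (2 * r) = y at *
    generalize p ^ (2 * r) = x at *
    field_simp at h3
    linear_combination x * h3
  · have := h.mod τ z
    simp only [map_mul, map_pow, ev_sX, div_eq_inv_mul] at this
    rw [one_mul, mul_pow, mul_pow, mul_assoc, this, div_eq_inv_mul]
    ring

/-- The value at `z = 0` as a modular form. -/
theorem exists_modularForm {w : ℤ} {G : CR}
    (h : ∀ τ : UpperHalfPlane, ev (ModularGroup.S • τ) 0 G = (τ : ℂ) ^ w * ev τ 0 G) :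
    ∃ f : ModularForm (Matrix.SpecialLinearGroup.mapGL (R := ℤ) ℝ).range w,
      ∀ τ, f τ = ev τ 0 G := by
  set g : UpperHalfPlane → ℂ := fun τ => ev τ 0 G with hg
  have hS : g ∣[w] ModularGroup.S = g := by
    ext τ
    rw [SlashInvariantForm.slash_S_apply, ← UpperHalfPlane.modular_S_smul, hg]
    simp only
    rw [h, mul_comm, ← mul_assoc, ← zpow_add₀ τ.ne_zero]
    simp
  have hT : g ∣[w] ModularGroup.T = g := by
    ext τ
    rw [ModularForm.SL_slash_apply, ModularGroup.denom_apply, UpperHalfPlane.modular_T_smul,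
      ModularGroup.T]
    have : g ((1 : ℝ) +ᵥ τ) = g τ := by
      refine (hasSum_ev _ _ _).unique (hasSum_of_eq (hasSum_ev τ 0 G) fun n => ?_)
      simp [e2_add, e2_one]
    simp [this]
  have hγ := SlashInvariantForm.slash_action_generators_SL2Z hS hT
  have hd := differentiableOn_series G
  refine ⟨{ toFun := g, slash_action_eq' := ?_, holo' := ?_, bdd_at_cusps' := ?_ }, fun τ => rfl⟩
  · rintro A ⟨A, rfl⟩
    exact hγ A
  · rw [UpperHalfPlane.mdifferentiable_iff]
    have h1 : DifferentiableOn ℂ (fun z => ∑' n, (cf n G).eval 0 * e2 z ^ n) {z | 0 < z.im} := by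
      refine hd.comp (t := Metric.ball 0 1) (f := e2) ?_ fun z hz => ?_
      · unfold e2; fun_prop
      · simpa using norm_e2_lt_one ⟨z, hz⟩
    refine h1.congr fun z hz => ?_
    have := (hasSum_ev ⟨z, hz⟩ 0 G).tsum_eq
    rw [sv_zero] at this
    simp only [SlashInvariantForm.coe_mk, Function.comp_apply,
      UpperHalfPlane.ofComplex_apply_of_im_pos hz]
    exact this.symm
  · intro c hc
    rw [Subgroup.IsArithmetic.isCusp_iff_isCusp_SL2Z] at hc
    rw [OnePoint.isBoundedAt_iff_forall_SL2Z hc]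
    intro γ _
    rw [hγ]
    refine UpperHalfPlane.isBoundedAtImInfty_of_hasSum_qExpansion one_pos
      (c := fun n => (cf n G).eval 0) fun τ => ?_
    have := hasSum_ev τ 0 G
    rw [sv_zero] at this
    simpa [qParam_one] using this

section

theorem modularForm_eq_zero {w : ℤ} (hw : w < 0 ∨ w = 2)
    (f : ModularForm (Matrix.SpecialLinearGroup.mapGL (R := ℤ) ℝ).range w)
    (τ : UpperHalfPlane) : f τ = 0 := by
  rcases hw with h | rfl
  · exact congrFun (ModularFormClass.levelOne_neg_weight_eq_zero h f) τ
  · have := rank_zero_iff_forall_zero.mp ModularForm.levelOne_weight_two_rank_zero f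
    rw [this]; rfl

theorem modularForm_const {w : ℤ} (hw : w = 0)
    (f : ModularForm (Matrix.SpecialLinearGroup.mapGL (R := ℤ) ℝ).range w) :
    ∃ c, ∀ τ, f τ = c := by
  subst hw
  obtain ⟨c, hc⟩ := ModularFormClass.levelOne_weight_zero_const f
  exact ⟨c, fun τ => congrFun hc τ⟩

variable {k : ℤ} {m r : ℕ} {F : CR}

theorem exists_lead (hF : Jac k m F) (h : ∀ n, ∀ i < r, (cf n F).coeff i = 0) :
    ∃ f : ModularForm (Matrix.SpecialLinearGroup.mapGL (R := ℤ) ℝ).range (2 * k + 2 * r),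
      ∀ τ : UpperHalfPlane, HasSum (fun n => (cf n F).coeff r * e2 τ ^ n) (f τ) := by
  obtain ⟨G, rfl, hG⟩ := exists_eq_sX_pow_mul r h
  obtain ⟨f, hf⟩ := exists_modularForm (lead_S hF)
  refine ⟨f, fun τ => ?_⟩
  rw [hf]
  refine hasSum_of_eq (hasSum_ev τ 0 G) fun n => ?_
  rw [sv_zero, ← Polynomial.coeff_zero_eq_eval_zero, hG]

theorem lead_zero (hF : Jac k m F) (h : ∀ n, ∀ i < r, (cf n F).coeff i = 0)
    (hk : k + r < 0 ∨ k + r = 1) (n : ℕ) : (cf n F).coeff r = 0 := by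
  obtain ⟨f, hf⟩ := exists_lead hF h
  refine eq_zero_of_qseries (a := fun n => (cf n F).coeff r) (fun τ => ?_) n
  have := hf τ
  rwa [modularForm_eq_zero (by omega) f τ] at this

theorem lead_const (hF : Jac k m F) (h : ∀ n, ∀ i < r, (cf n F).coeff i = 0)
    (hk : k + r = 0) (n : ℕ) : (cf (n + 1) F).coeff r = 0 := by
  obtain ⟨f, hf⟩ := exists_lead hF h
  obtain ⟨c, hc⟩ := modularForm_const (by omega) f
  have h1 := eq_zero_of_qseries (a := fun n => (cf n F).coeff r - if n = 0 then c else 0)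
    (fun τ => ?_) (n + 1)
  · simpa using h1
  · have h2 := (hf τ).sub (hasSum_ite_eq (0 : ℕ) c)
    rw [hc, sub_self] at h2
    refine hasSum_of_eq h2 fun n => ?_
    by_cases hn : n = 0 <;> simp [hn]

theorem lead_zero_of_neg (hF : Jac k m F) {d : ℕ} (hd : k + d ≤ 0) (n i : ℕ) (hi : i < d) :
    (cf n F).coeff i = 0 := by
  induction i using Nat.strong_induction_on generalizing n with
  | _ i ih => exact lead_zero hF (fun n j hj => ih j hj n (by omega)) (by omega) n

theorem Jac.cf_zero_eq_zero (hF : Jac k m F) (h : ∀ i ≤ m, (cf 0 F).coeff i = 0) : cf 0 F = 0 := by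
  ext i
  rw [Polynomial.coeff_zero]
  by_cases hi : i ≤ m
  · exact h i hi
  · exact Polynomial.coeff_eq_zero_of_natDegree_lt (by have := hF.natDegree_le; omega)

theorem Jac.eq_zero (hF : Jac k m F) (hk : k + m < 0) : F = 0 := by
  have key : ∀ n, ∀ (k : ℤ) (F : CR), Jac k m F → k + m < 0 → cf n F = 0 := by
    intro n
    induction n using Nat.strong_induction_on with
    | _ n ih =>
      intro k F hF hk
      have h0 : cf 0 F = 0 := hF.cf_zero_eq_zero fun i hi =>
        lead_zero_of_neg hF (d := m + 1) (by push_cast; omega) 0 i (by omega)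
      cases n with
      | zero => exact h0
      | succ n =>
        obtain ⟨G, rfl⟩ := exists_eq_qX_mul h0
        have h1 : G = G * DI * DD := by linear_combination -G * DI_mul_DD
        rw [cf_succ_qX_mul, h1, cf_mul]
        refine Finset.sum_eq_zero fun p hp => ?_
        have := Finset.HasAntidiagonal.mem_antidiagonal.mp hp
        rw [ih p.1 (by omega) (k - 6) _ hF.mul_DI (by omega), zero_mul]
  exact CR.ext_cf fun n => (key n k F hF hk).trans (cf_zero' n).symm

end

/-- A series with the coefficient `P r` at `q ^ g r`. -/
def sp (g : ℕ → ℕ) (hg : Function.Injective g) (P : ℕ → Polynomial ℂ)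
    (h : ∀ ρ : ℝ, 1 ≤ ρ → ∀ t : ℝ, 0 < t → t < 1 → Summable fun r => wnorm ρ (P r) * t ^ g r) :
    CR :=
  ⟨PowerSeries.mk (Function.extend g P 0), fun ρ hρ t ht ht1 => by
    refine (hg.summable_iff fun n hn => ?_).mp ?_
    · rw [PowerSeries.coeff_mk, Function.extend_apply' _ _ _ hn]
      simp [wnorm_zero]
    · refine (h ρ hρ t ht ht1).congr fun r => ?_
      simp [hg.extend_apply]⟩

theorem cf_sp_apply {g : ℕ → ℕ} (hg) {P : ℕ → Polynomial ℂ} (h) (r : ℕ) :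
    cf (g r) (sp g hg P h) = P r := by
  simp [cf, sp, hg.extend_apply]

theorem cf_sp_of_notMem {g : ℕ → ℕ} (hg) {P : ℕ → Polynomial ℂ} (h) {n : ℕ}
    (hn : n ∉ Set.range g) : cf n (sp g hg P h) = 0 := by
  simp only [cf, sp, PowerSeries.coeff_mk]
  rw [Function.extend_apply' _ _ _ hn]
  rfl

theorem hasSum_ev_sp {g : ℕ → ℕ} (hg) {P : ℕ → Polynomial ℂ} (h) (τ : UpperHalfPlane) (z : ℂ) :
    HasSum (fun r => (P r).eval (sv z) * e2 τ ^ g r) (ev τ z (sp g hg P h)) := by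
  refine hasSum_of_eq ((hg.hasSum_iff fun n hn => ?_).mpr (hasSum_ev τ z _)) fun r => ?_
  · rw [cf_sp_of_notMem hg h hn]; simp
  · simp only [Function.comp, cf_sp_apply]

theorem sp_mem_ZR {g : ℕ → ℕ} (hg) {P : ℕ → Polynomial ℂ} (h)
    (hP : ∀ r, ∃ Q : Polynomial ℤ, Q.map (Int.castRingHom ℂ) = P r) : sp g hg P h ∈ ZR := by
  rw [mem_ZR_iff]
  intro n
  by_cases hn : n ∈ Set.range g
  · obtain ⟨r, rfl⟩ := hn
    rw [cf_sp_apply]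
    exact hP r
  · exact ⟨0, by rw [cf_sp_of_notMem hg h hn]; simp⟩

theorem summable_pow_mul_pow_sq (C : ℝ) (hC : 1 ≤ C) (t : ℝ) (ht : 0 < t) (ht1 : t < 1) :
    Summable fun r : ℕ => C ^ r * t ^ (r ^ 2) := by
  have hC0 : 0 < C := by linarith
  refine summable_of_ratio_test_tendsto_lt_one (l := 0) one_pos
    (Filter.Eventually.of_forall fun r => by positivity) ?_
  have h1 : Filter.Tendsto (fun r : ℕ => C * t * (t ^ 2) ^ r) Filter.atTop (𝓝 (C * t * 0)) :=
    (tendsto_pow_atTop_nhds_zero_of_lt_one (by positivity) (by nlinarith)).const_mul _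
  rw [mul_zero] at h1
  refine h1.congr fun r => ?_
  rw [Real.norm_of_nonneg (by positivity), Real.norm_of_nonneg (by positivity)]
  have h2 : t ^ ((r + 1) ^ 2) = t ^ (r ^ 2) * (t ^ 2) ^ r * t := by
    rw [← pow_mul, ← pow_add, ← pow_succ]; ring_nf
  rw [h2, pow_succ]
  field_simp
  exact (pow_succ' C r).symm

theorem summable_wnorm_sq (P : ℕ → Polynomial ℂ) (g : ℕ → ℕ) (hg : ∀ r, r ^ 2 ≤ g r)
    (hP : ∀ ρ : ℝ, 1 ≤ ρ → ∀ r, wnorm ρ (P r) ≤ 2 * (ρ + 3) ^ (2 * r + 1)) (ρ : ℝ) (hρ : 1 ≤ ρ)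
    (t : ℝ) (ht : 0 < t) (ht1 : t < 1) : Summable fun r => wnorm ρ (P r) * t ^ g r := by
  refine Summable.of_nonneg_of_le (fun r => ?_) (fun r => ?_)
    ((summable_pow_mul_pow_sq ((ρ + 3) ^ 2) (by nlinarith) t ht ht1).mul_left (2 * (ρ + 3)))
  · have := wnorm_nonneg (by linarith : 0 ≤ ρ) (P r)
    positivity
  · calc wnorm ρ (P r) * t ^ g r ≤ (2 * (ρ + 3) ^ (2 * r + 1)) * t ^ (r ^ 2) := by
          refine mul_le_mul (hP ρ hρ r) (pow_le_pow_of_le_one ht.le ht1.le (hg r)) (by positivity)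
            (by positivity)
      _ = _ := by rw [pow_succ, pow_mul]; ring

theorem injective_sq : Function.Injective fun r : ℕ => r ^ 2 :=
  Nat.pow_left_injective two_ne_zero

theorem injective_mul_succ : Function.Injective fun r : ℕ => r * (r + 1) :=
  StrictMono.injective (strictMono_nat_of_lt_succ fun r => by nlinarith)

/-- The theta series with even exponents of `ζ`. -/
def T0 : CR := sp _ injective_sq (fun r => (wl (2 * r)).map (Int.castRingHom ℂ))
  (summable_wnorm_sq _ _ (fun _ => le_rfl) fun ρ hρ r =>
    (wnorm_wl_le (by linarith) _).trans (by gcongr <;> linarith))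

/-- The theta series with odd exponents of `ζ`, divided by `q ^ (1 / 4)`. -/
def T1 : CR := sp _ injective_mul_succ (fun r => vlc (2 * r + 1))
  (summable_wnorm_sq _ _ (fun r => by nlinarith) fun ρ hρ r => wnorm_vlc_le (by linarith) _)

/-- Half of the value of `T1` at `z = 0`. -/
def Tb : CR := sp _ injective_mul_succ (fun _ => 1)
  (summable_wnorm_sq _ _ (fun r => by nlinarith) fun ρ hρ r => by
    have := wnorm_C ρ 1
    rw [Polynomial.C_1, norm_one] at this
    rw [this]
    have := one_le_pow₀ (by linarith : 1 ≤ ρ + 3) (n := 2 * r + 1)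
    linarith)

theorem T0_mem_ZR : T0 ∈ ZR := sp_mem_ZR _ _ fun _ => ⟨_, rfl⟩

theorem T1_mem_ZR : T1 ∈ ZR := sp_mem_ZR _ _ fun _ => ⟨_, rfl⟩

theorem Tb_mem_ZR : Tb ∈ ZR := sp_mem_ZR _ _ fun _ => ⟨1, by simp⟩

theorem cf_zero_T0 : cf 0 T0 = 1 := by
  have := cf_sp_apply injective_sq (P := fun r => (wl (2 * r)).map (Int.castRingHom ℂ))
    (summable_wnorm_sq _ _ (fun _ => le_rfl) fun ρ hρ r =>
    (wnorm_wl_le (by linarith) _).trans (by gcongr <;> linarith)) 0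
  simpa [T0, wl] using this

theorem cf_zero_T1 : cf 0 T1 = Polynomial.X + 2 := by
  have := cf_sp_apply injective_mul_succ (P := fun r => vlc (2 * r + 1))
    (summable_wnorm_sq _ _ (fun r => by nlinarith) fun ρ hρ r => wnorm_vlc_le (by linarith) _) 0
  simpa [T1, vlc_one] using this

theorem cf_zero_Tb : cf 0 Tb = 1 :=
  cf_sp_apply injective_mul_succ (P := fun _ => 1) _ 0

/-- Restriction to `z = 0`. -/
def r0 (F : CR) : CR := qs (fun n => (cf n F).coeff 0) fun t ht ht1 => by
  refine Summable.of_nonneg_of_le (fun _ => by positivity) (fun n => ?_)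
    (summable_wnorm F zero_le_one ht.le ht1)
  gcongr
  simpa using coeff_le_wnorm zero_le_one (cf n F) 0

theorem ev_r0 (τ : UpperHalfPlane) (z : ℂ) (F : CR) : ev τ z (r0 F) = ev τ 0 F := by
  refine (hasSum_ev_qs _ _ τ z).unique (hasSum_of_eq (hasSum_ev τ 0 F) fun n => ?_)
  rw [sv_zero, Polynomial.coeff_zero_eq_eval_zero]

theorem r0_mem_ZR {F : CR} (h : F ∈ ZR) : r0 F ∈ ZR := by
  refine qs_mem_ZR _ fun n => ?_
  obtain ⟨P, hP⟩ := mem_ZR_iff.mp h n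
  exact ⟨P.coeff 0, by rw [← hP]; simp⟩

theorem cf_zero_r0 (F : CR) : cf 0 (r0 F) = Polynomial.C ((cf 0 F).coeff 0) := cf_qs _ _ _

theorem ev_Tb (τ : UpperHalfPlane) (z : ℂ) : ev τ 0 T1 = 2 * ev τ z Tb := by
  refine (hasSum_ev_sp _ _ τ 0).unique (hasSum_of_eq ((hasSum_ev_sp _ _ τ z).mul_left 2)
    fun r => ?_)
  rw [eval_vlc, mul_zero, neg_zero, e2_zero, Polynomial.eval_one]
  ring

theorem hasSum_T0 (τ : UpperHalfPlane) (z : ℂ) :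
    HasSum (fun n : ℤ => e2 (n * (2 * z) + n ^ 2 * τ)) (jacobiTheta₂ (2 * z) (2 * τ)) := by
  refine hasSum_of_eq (hasSum_jacobiTheta₂_term (2 * z) (τ := 2 * τ) ?_) fun n => ?_
  · simpa using τ.im_pos
  · rw [jacobiTheta₂_term, e2]
    congr 1; ring

theorem hasSum_T1 (τ : UpperHalfPlane) (z : ℂ) :
    HasSum (fun n : ℤ => e2 ((2 * n + 1) * z + n * (n + 1) * τ))
      (e2 z * jacobiTheta₂ (2 * z + τ) (2 * τ)) := by
  refine hasSum_of_eq ((hasSum_jacobiTheta₂_term (2 * z + τ) (τ := 2 * τ) ?_).mul_left (e2 z))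
    fun n => ?_
  · simpa using τ.im_pos
  · rw [jacobiTheta₂_term, e2, e2, ← Complex.exp_add]
    congr 1; ring

theorem ev_T0 (τ : UpperHalfPlane) (z : ℂ) : ev τ z T0 = jacobiTheta₂ (2 * z) (2 * τ) := by
  have h1 := (hasSum_T0 τ z).nat_add_neg
  have h2 := h1.sub (hasSum_ite_eq (0 : ℕ) (1 : ℂ))
  refine (hasSum_ev_sp _ _ τ z).unique ?_
  convert! h2 using 1
  · funext r
    rcases Nat.eq_zero_or_pos r with rfl | hr
    · simp [wl, e2_zero]
    · have h3 : (wl (2 * r)).map (Int.castRingHom ℂ) = vlc (2 * r) := by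
        rw [wl, if_neg (by omega)]; rfl
      rw [h3, eval_vlc, if_neg (by omega), ← e2_nat_mul, add_mul, ← e2_add, ← e2_add]
      push_cast
      ring_nf
  · simp [e2_zero]

theorem ev_T1 (τ : UpperHalfPlane) (z : ℂ) :
    ev τ z T1 = e2 z * jacobiTheta₂ (2 * z + τ) (2 * τ) := by
  refine (hasSum_ev_sp _ _ τ z).unique (hasSum_of_eq (hasSum_T1 τ z).nat_add_neg_add_one
    fun r => ?_)
  rw [eval_vlc, ← e2_nat_mul, add_mul, ← e2_add, ← e2_add]
  push_cast
  ring_nf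

theorem ev_neg (τ : UpperHalfPlane) (z : ℂ) (F : CR) : ev τ (-z) F = ev τ z F := by
  have h : sv (-z) = sv z := by simp only [sv, neg_neg]; ring
  exact (hasSum_ev τ (-z) F).unique (hasSum_of_eq (hasSum_ev τ z F) fun n => by rw [h])

theorem T0_ell (τ : UpperHalfPlane) (z : ℂ) :
    ev τ (z + τ) T0 = e2 (-(τ + 2 * z)) * ev τ z T0 := by
  rw [ev_T0, ev_T0, mul_add, jacobiTheta₂_add_left', e2]
  congr 2; ring

theorem T1_ell (τ : UpperHalfPlane) (z : ℂ) :
    ev τ (z + τ) T1 = e2 (-(τ + 2 * z)) * ev τ z T1 := by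
  rw [ev_T1, ev_T1, show 2 * (z + τ) + (τ : ℂ) = 2 * z + τ + 2 * τ by ring,
    jacobiTheta₂_add_left', ← mul_assoc, ← mul_assoc, e2, e2, e2, ← Complex.exp_add,
    ← Complex.exp_add]
  congr 2; ring

theorem hasSum_int_even_add_odd {f : ℤ → ℂ} {a b : ℂ} (he : HasSum (fun k => f (2 * k)) a)
    (ho : HasSum (fun k => f (2 * k + 1)) b) : HasSum f (a + b) := by
  have h2 : Function.Injective fun k : ℤ => 2 * k := fun a b h => by simpa using h
  replace ho := ((add_left_injective (1 : ℤ)).comp h2).hasSum_range_iff.2 ho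
  refine (h2.hasSum_range_iff.2 he).add_isCompl ?_ ho
  simpa [Function.comp_def] using Int.isCompl_even_odd

theorem theta_split (τ : UpperHalfPlane) (z : ℂ) :
    jacobiTheta₂ z (τ / 2) = ev τ z T0 + e2 (τ / 4) * ev τ z T1 := by
  have h0 := hasSum_T0 τ z
  have h1 := (hasSum_T1 τ z).mul_left (e2 (τ / 4))
  rw [← ev_T0] at h0
  rw [← ev_T1] at h1
  have h := hasSum_jacobiTheta₂_term z (τ := τ / 2) (by
    have := τ.im_pos
    simpa using this)
  refine h.unique (hasSum_int_even_add_odd (hasSum_of_eq h0 fun n => ?_)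
    (hasSum_of_eq h1 fun n => ?_))
  · rw [jacobiTheta₂_term, e2]
    congr 1; push_cast; ring
  · rw [jacobiTheta₂_term, e2, e2, ← Complex.exp_add]
    congr 1; push_cast; ring

theorem T0_S (τ : UpperHalfPlane) (z : ℂ) :
    ev (ModularGroup.S • τ) (z / τ) T0 = (-I * (τ / 2)) ^ (1 / 2 : ℂ) * e2 (z ^ 2 / τ) *
      (ev τ z T0 + e2 (τ / 4) * ev τ z T1) := by
  have hτ := τ.ne_zero
  have h0 : -I * ((τ : ℂ) / 2) ≠ 0 := by simp [hτ]
  have hc : (-I * ((τ : ℂ) / 2)) ^ (1 / 2 : ℂ) ≠ 0 := by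
    rw [Ne, Complex.cpow_eq_zero_iff]; tauto
  have h := jacobiTheta₂_functional_equation z (τ / 2)
  rw [theta_split] at h
  rw [ev_T0, coe_S_smul, h]
  have h1 : Complex.exp (-Real.pi * I * z ^ 2 / (τ / 2)) = (e2 (z ^ 2 / τ))⁻¹ := by
    rw [e2, ← Complex.exp_neg]
    congr 1; field_simp
  have h2 : z / ((τ : ℂ) / 2) = 2 * (z / τ) := by field_simp
  have h3 : -1 / ((τ : ℂ) / 2) = 2 * (-1 / τ) := by field_simp
  rw [h1, h2, h3]
  have := e2_ne_zero (z ^ 2 / τ)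
  field_simp

theorem cpow_half_re_pos (τ : UpperHalfPlane) : 0 < ((-I * (τ / 2)) ^ (1 / 2 : ℂ)).re := by
  rw [one_div, Complex.cpow_inv_two_re, Real.sqrt_pos]
  have : 0 < (-I * ((τ : ℂ) / 2)).re := by
    have := τ.im_pos
    simpa using this
  positivity

theorem cpow_half_sq (τ : UpperHalfPlane) : ((-I * (τ / 2)) ^ (1 / 2 : ℂ)) ^ 2 = -I * (τ / 2) := by
  rw [one_div]
  exact Complex.cpow_nat_inv_pow _ two_ne_zero

theorem theta_S (τ : UpperHalfPlane) : ∃ c : ℂ, c ^ 2 = -I * (τ / 2) ∧ ∀ z,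
    ev (ModularGroup.S • τ) (z / τ) T0 =
      c * e2 (z ^ 2 / τ) * (ev τ z T0 + e2 (τ / 4) * ev τ z T1) ∧
    e2 ((ModularGroup.S • τ : UpperHalfPlane) / 4) * ev (ModularGroup.S • τ) (z / τ) T1 =
      c * e2 (z ^ 2 / τ) * (ev τ z T0 - e2 (τ / 4) * ev τ z T1) := by
  refine ⟨_, cpow_half_sq τ, fun z => ⟨T0_S τ z, ?_⟩⟩
  have h1 := T0_S τ z
  have h2 := T0_S (ModularGroup.S • τ) (z / τ)
  have hp := cpow_half_re_pos τ
  have hp' := cpow_half_re_pos (ModularGroup.S • τ)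
  have hs := cpow_half_sq τ
  have hs' := cpow_half_sq (ModularGroup.S • τ)
  have hτ := τ.ne_zero
  have hSS : ModularGroup.S • ModularGroup.S • τ = τ := by
    apply UpperHalfPlane.ext
    rw [coe_S_smul, coe_S_smul]
    field_simp
  rw [hSS] at h2
  set c := (-I * ((τ : ℂ) / 2)) ^ (1 / 2 : ℂ) with hc
  set c' := (-I * (((ModularGroup.S • τ : UpperHalfPlane) : ℂ) / 2)) ^ (1 / 2 : ℂ) with hc'
  set p' := e2 ((ModularGroup.S • τ : UpperHalfPlane) / 4)
  rw [coe_S_smul] at hs' h2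
  have h3 : z / τ / (-1 / (τ : ℂ)) = -z := by field_simp
  have h4 : (z / τ) ^ 2 / (-1 / (τ : ℂ)) = -(z ^ 2 / τ) := by field_simp
  rw [h3, h4, ev_neg, e2_neg] at h2
  have hcc : (c * c') ^ 2 = (1 / 2) ^ 2 := by
    rw [mul_pow, hs, hs']
    field_simp
    rw [I_sq]; norm_num
  have hcc2 : c * c' = 1 / 2 := by
    rcases sq_eq_sq_iff_eq_or_eq_neg.mp hcc with h | h
    · exact h
    · exfalso
      have h5 : c.re * c'.re - c.im * c'.im = -(1 / 2) := by
        have := congrArg Complex.re h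
        norm_num at this ⊢
        linarith
      have h6 : c.re * c'.im + c.im * c'.re = 0 := by
        have := congrArg Complex.im h
        norm_num at this
        linarith
      have h7 : c.re * (c'.re ^ 2 + c'.im ^ 2) = -(c'.re / 2) := by
        linear_combination c'.re * h5 + c'.im * h6
      have h8 : 0 < c.re * (c'.re ^ 2 + c'.im ^ 2) := by positivity
      linarith
  have he := e2_ne_zero (z ^ 2 / τ)
  have hc0 : c ≠ 0 := by
    rintro h; simp [h] at hp
  have h7 : ev τ z T0 = c' * (e2 (z ^ 2 / τ))⁻¹ * (c * e2 (z ^ 2 / τ) *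
      (ev τ z T0 + e2 (τ / 4) * ev τ z T1) + p' * ev (ModularGroup.S • τ) (z / τ) T1) := by
    rw [← h1]; exact h2
  have h8 : 2 * c * e2 (z ^ 2 / τ) * ev τ z T0 = c * e2 (z ^ 2 / τ) *
      (ev τ z T0 + e2 (τ / 4) * ev τ z T1) + p' * ev (ModularGroup.S • τ) (z / τ) T1 := by
    have hei := mul_inv_cancel₀ he
    set e := e2 (z ^ 2 / τ)
    set R := c * e * (ev τ z T0 + e2 (τ / 4) * ev τ z T1) +
      p' * ev (ModularGroup.S • τ) (z / τ) T1
    linear_combination 2 * c * e * h7 + 2 * e * e⁻¹ * R * hcc2 + R * hei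
  linear_combination -h8

theorem Jac.of_theta {k : ℕ} {F : CR} (G : ℂ → ℂ → ℂ → ℂ → ℂ)
    (hev : ∀ (τ : UpperHalfPlane) (z : ℂ), ev τ z F =
      G (ev τ 0 T0) (e2 (τ / 4) * ev τ 0 T1) (ev τ z T0) (e2 (τ / 4) * ev τ z T1))
    (hS : ∀ c τ x y a b e : ℂ, c ^ 2 = -I * (τ / 2) →
      G (c * (x + y)) (c * (x - y)) (c * e * (a + b)) (c * e * (a - b)) =
        τ ^ (2 * k) * e * G x y a b)
    (hell : ∀ x y a b e : ℂ, G x y (e * a) (e * b) = e * G x y a b) : Jac k 1 F where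
  mod τ z := by
    obtain ⟨c, hc, h⟩ := theta_S τ
    have h0 := h 0
    rw [zero_div, zero_pow two_ne_zero, zero_div, e2_zero, mul_one] at h0
    rw [hev, hev, h0.1, h0.2, (h z).1, (h z).2, hS _ _ _ _ _ _ _ hc]
    norm_cast
    simp
  ell τ z := by
    rw [hev, hev, T0_ell, T1_ell, mul_left_comm, hell]
    simp

/-- The theta constant of `T0`. -/
def TX : CR := r0 T0

theorem TX_mem_ZR : TX ∈ ZR := r0_mem_ZR T0_mem_ZR

theorem cf_zero_TX : cf 0 TX = 1 := by
  rw [TX, cf_zero_r0, cf_zero_T0]; simp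

/-- A root of the discriminant. -/
def TW : CR := TX * Tb * (TX ^ 4 - 16 * (qX * Tb ^ 4))

theorem TW_mem_ZR : TW ∈ ZR :=
  mul_mem (mul_mem TX_mem_ZR Tb_mem_ZR) (sub_mem (pow_mem TX_mem_ZR _)
    (mul_mem (ofNat_mem _ _) (mul_mem qX_mem_ZR (pow_mem Tb_mem_ZR _))))

theorem cf_zero_TW : cf 0 TW = 1 := by
  simp [TW, cf_zero_TX, cf_zero_Tb]

/-- The form of weight `-2` and index `1`. -/
def FA : CR := (TX * T1 - 2 * (Tb * T0)) * TW ^ 3 * DI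

/-- The form of weight `0` and index `1`. -/
def FB : CR := ((10 * (TX ^ 4 * Tb) - 32 * (qX * Tb ^ 5)) * T0 +
  (TX ^ 5 - 80 * (qX * (TX * Tb ^ 4))) * T1) * TW ^ 3 * DI

/-- The Jacobi Eisenstein series of weight `4` and index `1`. -/
def FE : CR := (TX ^ 7 + 112 * (qX * (TX ^ 3 * Tb ^ 4))) * T0 +
  qX * ((56 * (TX ^ 4 * Tb ^ 3) + 128 * (qX * Tb ^ 7)) * T1)

@[simp] theorem cf_zero_ofNat (n : ℕ) [n.AtLeastTwo] : cf 0 (ofNat(n) : CR) = ofNat(n) := by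
  have : ∀ n : ℕ, cf 0 (n : CR) = n := fun n => by
    induction n with
    | zero => simp
    | succ n ih => simp [ih]
  exact this n

theorem cf_zero_FA : cf 0 FA = Polynomial.X := by
  simp [FA, cf_zero_TX, cf_zero_Tb, cf_zero_TW, cf_zero_T0, cf_zero_T1, cf_zero_DI]

theorem cf_zero_FB : cf 0 FB = Polynomial.X + 12 := by
  simp [FB, cf_zero_TX, cf_zero_Tb, cf_zero_TW, cf_zero_T0, cf_zero_T1, cf_zero_DI]
  ring

theorem cf_zero_FE : cf 0 FE = 1 := by
  simp [FE, cf_zero_TX, cf_zero_Tb, cf_zero_T0]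

theorem e2_quarter (τ : UpperHalfPlane) : e2 τ = e2 (τ / 4) ^ 4 := by
  rw [← e2_nat_mul]
  congr 1; push_cast; ring

theorem mul_DI_mul_DT (F : CR) : F * DI * DT = qX * F := by
  rw [DT]
  linear_combination F * qX * DI_mul_DD

theorem pow_aux (c τ : ℂ) (h : c ^ 2 = -I * (τ / 2)) : c ^ 4 = -(τ ^ 2 / 4) := by
  have : c ^ 4 = (c ^ 2) ^ 2 := by ring
  rw [this, h, mul_pow, neg_sq, I_sq]; ring

theorem FE_mem_ZR : FE ∈ ZR := by
  have h1 := TX_mem_ZR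
  have h2 := Tb_mem_ZR
  have h3 := qX_mem_ZR
  have h4 := T0_mem_ZR
  have h5 := T1_mem_ZR
  unfold FE
  with_reducible
    repeat' first
      | assumption | apply add_mem | apply mul_mem | apply pow_mem | apply ofNat_mem

theorem FA_mem_ZR : FA ∈ ZR := by
  have h1 := TX_mem_ZR
  have h2 := Tb_mem_ZR
  have h3 := TW_mem_ZR
  have h4 := T0_mem_ZR
  have h5 := T1_mem_ZR
  have h6 := DI_mem_ZR
  unfold FA
  with_reducible
    repeat' first
      | assumption | apply add_mem | apply sub_mem | apply mul_mem | apply pow_mem | apply ofNat_mem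

theorem Jac_FE : Jac 2 1 FE := by
  refine Jac.of_theta (k := 2) (fun x y a b => (x ^ 7 + 7 * x ^ 3 * y ^ 4) * a +
    (7 * x ^ 4 * y ^ 3 + y ^ 7) * b) (fun τ z => ?_) (fun c τ x y a b e hc => ?_)
    fun x y a b e => by ring
  · simp only [FE, map_add, map_mul, map_pow, map_ofNat, ev_qX, TX, ev_r0, e2_quarter,
      ev_Tb τ z]
    ring
  · have h8 : c ^ 8 = τ ^ 4 / 16 := by
      rw [show c ^ 8 = (c ^ 4) ^ 2 by ring, pow_aux c τ hc]; ring
    linear_combination 16 * e * ((x ^ 7 + 7 * x ^ 3 * y ^ 4) * a +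
      (7 * x ^ 4 * y ^ 3 + y ^ 7) * b) * h8

theorem theta_disc_aux (c x y : ℂ) : (c * (x + y)) * (c * (x - y)) *
    ((c * (x + y)) ^ 4 - (c * (x - y)) ^ 4) / 2 = 8 * c ^ 6 * (x * y * (x ^ 4 - y ^ 4) / 2) := by
  ring

theorem ev_TW (τ : UpperHalfPlane) (z : ℂ) : e2 (τ / 4) * ev τ z TW =
    ev τ 0 T0 * (e2 (τ / 4) * ev τ 0 T1) *
      (ev τ 0 T0 ^ 4 - (e2 (τ / 4) * ev τ 0 T1) ^ 4) / 2 := by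
  simp only [TW, map_mul, map_sub, map_pow, map_ofNat, ev_qX, TX, ev_r0, e2_quarter, ev_Tb τ z]
  ring

theorem Jac_FA : Jac (-1) 1 FA := by
  refine (Jac.of_mul_DT ?_).cast (by norm_num : (5 : ℤ) - 6 = -1) rfl
  rw [FA, mul_DI_mul_DT]
  refine Jac.of_theta (k := 5) (fun x y a b => (x * b - y * a) * (x * y * (x ^ 4 - y ^ 4) / 2) ^ 3)
    (fun τ z => ?_) (fun c τ x y a b e hc => ?_) fun x y a b e => by ring
  · simp only [← ev_TW τ z]
    simp only [map_mul, map_sub, map_pow, map_ofNat, ev_qX, TX, ev_r0, e2_quarter,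
      ev_Tb τ z]
    ring
  · have h20 : c ^ 20 = -(τ ^ 10 / 1024) := by
      rw [show c ^ 20 = (c ^ 4) ^ 5 by ring, pow_aux c τ hc]; ring
    simp only [theta_disc_aux]
    generalize x * y * (x ^ 4 - y ^ 4) / 2 = w
    linear_combination -1024 * e * (x * b - y * a) * w ^ 3 * h20

theorem Jac_FB : Jac 0 1 FB := by
  refine (Jac.of_mul_DT ?_).cast (by norm_num : (6 : ℤ) - 6 = 0) rfl
  rw [FB, mul_DI_mul_DT]
  refine Jac.of_theta (k := 6) (fun x y a b => ((5 * x ^ 4 * y - y ^ 5) * a +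
    (x ^ 5 - 5 * x * y ^ 4) * b) * (x * y * (x ^ 4 - y ^ 4) / 2) ^ 3)
    (fun τ z => ?_) (fun c τ x y a b e hc => ?_) fun x y a b e => by ring
  · simp only [← ev_TW τ z]
    simp only [map_add, map_mul, map_sub, map_pow, map_ofNat, ev_qX, TX, ev_r0, e2_quarter,
      ev_Tb τ z]
    ring
  · have h24 : c ^ 24 = τ ^ 12 / 4096 := by
      rw [show c ^ 24 = (c ^ 4) ^ 6 by ring, pow_aux c τ hc]; ring
    simp only [theta_disc_aux]
    generalize x * y * (x ^ 4 - y ^ 4) / 2 = w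
    linear_combination 4096 * e * ((5 * x ^ 4 * y - y ^ 5) * a +
      (x ^ 5 - 5 * x * y ^ 4) * b) * w ^ 3 * h24

theorem cf_zero_E4 : cf 0 E4 = 1 := by
  simp [E4, sg]

theorem cf_zero_E6 : cf 0 E6 = 1 := by
  simp [E6, sg]

theorem twelve_FE : 12 * FE = E4 * FB - E6 * FA := by
  have h1 : Jac 2 1 (12 * FE - (E4 * FB - E6 * FA)) := by
    refine (?_ : Jac 2 1 (12 * FE)).sub (((Jac_E4.mul Jac_FB).cast (by norm_num) (by norm_num)).sub
      ((Jac_E6.mul Jac_FA).cast (by norm_num) (by norm_num)))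
    exact_mod_cast Jac.int_mul 12 Jac_FE
  obtain ⟨G, hG⟩ := exists_eq_qX_mul (F := 12 * FE - (E4 * FB - E6 * FA)) (by
    simp [cf_zero_FE, cf_zero_E4, cf_zero_E6, cf_zero_FA, cf_zero_FB])
  rw [hG] at h1
  have h2 := Jac.eq_zero h1.mul_DI (by norm_num)
  have h3 : G = 0 := by
    have : G = G * DI * DD := by rw [mul_assoc, DI_mul_DD, mul_one]
    rw [this, h2, zero_mul]
  rw [h3, mul_zero] at hG
  exact sub_eq_zero.mp hG

/-- The quasi-modular companion with `FB = FA + 12 FC`. -/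
def FC : CR := FE - 20 * (sg 3 * FB) - 42 * (sg 5 * FA)

theorem FB_eq : FB = FA + 12 * FC := by
  have := twelve_FE
  rw [E4, E6] at this
  rw [FC]
  linear_combination -this

theorem FC_mem_ZR : FC ∈ ZR := by
  have hB : FB ∈ ZR := by
    have h1 := TX_mem_ZR
    have h2 := Tb_mem_ZR
    have h3 := TW_mem_ZR
    have h4 := T0_mem_ZR
    have h5 := T1_mem_ZR
    have h6 := DI_mem_ZR
    have h7 := qX_mem_ZR
    unfold FB
    with_reducible
      repeat' first
        | assumption | apply add_mem | apply sub_mem | apply mul_mem | apply pow_mem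
        | apply ofNat_mem
  exact sub_mem (sub_mem FE_mem_ZR (mul_mem (ofNat_mem _ _) (mul_mem (sg_mem_ZR _) hB)))
    (mul_mem (ofNat_mem _ _) (mul_mem (sg_mem_ZR _) FA_mem_ZR))

/-- The value at `q = 0` and `z = 0`. -/
def v0 : CR →+* ℂ where
  toFun F := (cf 0 F).coeff 0
  map_one' := by simp
  map_mul' F G := by simp [Polynomial.mul_coeff_zero]
  map_zero' := by simp
  map_add' F G := by simp

theorem v0_apply (F : CR) : v0 F = (cf 0 F).coeff 0 := rfl

theorem v0_FA : v0 FA = 0 := by simp [v0_apply, cf_zero_FA]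

theorem v0_FB : v0 FB = 12 := by simp [v0_apply, cf_zero_FB]

theorem v0_FC : v0 FC = 1 := by
  have := congrArg v0 FB_eq
  simp only [map_add, map_mul, map_ofNat, v0_FA, v0_FB] at this
  linear_combination -this / 12

theorem v0_E4 : v0 E4 = 1 := by simp [v0_apply, cf_zero_E4]

theorem v0_E6 : v0 E6 = 1 := by simp [v0_apply, cf_zero_E6]

theorem E6_eq : E6 = 1 - 864 * sb + 360 * sg 3 := by
  rw [E6]
  linear_combination 72 * twelve_sb

/-- There is an integral weak Jacobi form of weight `2k` and index `m` with value `c` at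
`q = 0`, `z = 0`. -/
def Rep (k : ℤ) (m : ℕ) (c : ℤ) : Prop := ∃ ψ ∈ ZR, Jac k m ψ ∧ v0 ψ = c

namespace Rep

variable {k k' : ℤ} {m m' : ℕ} {c c' : ℤ}

theorem mul (h : Rep k m c) (h' : Rep k' m' c') : Rep (k + k') (m + m') (c * c') := by
  obtain ⟨ψ, h1, h2, h3⟩ := h
  obtain ⟨ψ', h1', h2', h3'⟩ := h'
  exact ⟨ψ * ψ', mul_mem h1 h1', h2.mul h2', by rw [map_mul, h3, h3']; norm_cast⟩

theorem sub (h : Rep k m c) (h' : Rep k m c') : Rep k m (c - c') := by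
  obtain ⟨ψ, h1, h2, h3⟩ := h
  obtain ⟨ψ', h1', h2', h3'⟩ := h'
  exact ⟨ψ - ψ', sub_mem h1 h1', h2.sub h2', by rw [map_sub, h3, h3']; norm_cast⟩

theorem int_mul (n : ℤ) (h : Rep k m c) : Rep k m (n * c) := by
  obtain ⟨ψ, h1, h2, h3⟩ := h
  exact ⟨n * ψ, mul_mem (intCast_mem _ _) h1, h2.int_mul n, by simp [h3]⟩

theorem cast (h : Rep k m c) (hk : k = k') (hm : m = m') (hc : c = c') : Rep k' m' c' := by
  subst hk hm hc; exact h

end Rep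

/-- The integral form of weight `0` and index `2`. -/
def G2 : CR := FA * FC + 6 * FC ^ 2 - 10 * sg 3 * FA ^ 2

/-- The integral form of weight `0` and index `3`. -/
def G3 : CR := FA * FC ^ 2 + 4 * FC ^ 3 - 20 * sg 3 * FA ^ 2 * FC - 4 * sb * FA ^ 3

/-- The integral form of weight `0` and index `4`. -/
def G4 : CR := 3 * FC ^ 4 + FA * FC ^ 3 - 30 * sg 3 * FA ^ 2 * FC ^ 2 - 12 * sb * FA ^ 3 * FC -
  (sb + 25 * sg 3 ^ 2) * FA ^ 4

theorem Jac_G2 : Jac 0 2 G2 := by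
  refine Jac.of_int_mul (n := 24) (by norm_num) ?_
  have h := ((Jac_FB.pow 2).cast (by norm_num) (by norm_num)).sub
    ((Jac_E4.mul (Jac_FA.pow 2)).cast (k' := 0) (m' := 2) (by norm_num) (by norm_num))
  convert! h using 1
  rw [G2, FB_eq, E4]
  push_cast
  ring

theorem Jac_G3 : Jac 0 3 G3 := by
  refine Jac.of_int_mul (n := 432) (by norm_num) ?_
  have h := (((Jac_FB.pow 3).cast (by norm_num) (by norm_num)).sub
    (((Jac_E4.mul ((Jac_FA.pow 2).mul Jac_FB)).int_mul 3).cast (k' := 0) (m' := 3)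
      (by norm_num) (by norm_num))).add
    (((Jac_E6.mul (Jac_FA.pow 3)).int_mul 2).cast (k' := 0) (m' := 3)
      (by norm_num) (by norm_num))
  convert! h using 1
  rw [G3, FB_eq, E6_eq, E4]
  push_cast
  ring

theorem Jac_G4 : Jac 0 4 G4 := by
  refine Jac.of_int_mul (n := 6912) (by norm_num) ?_
  have h := ((((Jac_FB.pow 4).cast (by norm_num) (by norm_num)).sub
    (((Jac_E4.mul ((Jac_FA.pow 2).mul (Jac_FB.pow 2))).int_mul 6).cast (k' := 0) (m' := 4)
      (by norm_num) (by norm_num))).add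
    (((Jac_E6.mul ((Jac_FA.pow 3).mul Jac_FB)).int_mul 8).cast (k' := 0) (m' := 4)
      (by norm_num) (by norm_num))).sub
    ((((Jac_E4.pow 2).mul (Jac_FA.pow 4)).int_mul 3).cast (k' := 0) (m' := 4)
      (by norm_num) (by norm_num))
  convert! h using 1
  rw [G4, FB_eq, E6_eq, E4]
  push_cast
  ring

theorem G2_mem_ZR : G2 ∈ ZR := by
  have h1 := FA_mem_ZR
  have h2 := FC_mem_ZR
  have h3 := sg_mem_ZR 3
  unfold G2
  with_reducible
    repeat' first
      | assumption | apply add_mem | apply sub_mem | apply mul_mem | apply pow_mem | apply ofNat_mem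

theorem G3_mem_ZR : G3 ∈ ZR := by
  have h1 := FA_mem_ZR
  have h2 := FC_mem_ZR
  have h3 := sg_mem_ZR 3
  have h4 := sb_mem_ZR
  unfold G3
  with_reducible
    repeat' first
      | assumption | apply add_mem | apply sub_mem | apply mul_mem | apply pow_mem | apply ofNat_mem

theorem G4_mem_ZR : G4 ∈ ZR := by
  have h1 := FA_mem_ZR
  have h2 := FC_mem_ZR
  have h3 := sg_mem_ZR 3
  have h4 := sb_mem_ZR
  unfold G4
  with_reducible
    repeat' first
      | assumption | apply add_mem | apply sub_mem | apply mul_mem | apply pow_mem | apply ofNat_mem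

theorem Rep_FB : Rep 0 1 12 :=
  ⟨FB, by
    rw [FB_eq]
    exact add_mem FA_mem_ZR (mul_mem (ofNat_mem _ _) FC_mem_ZR), Jac_FB, by simp [v0_FB]⟩

theorem Rep_G2 : Rep 0 2 6 :=
  ⟨G2, G2_mem_ZR, Jac_G2, by simp [G2, v0_FA, v0_FC, map_ofNat]⟩

theorem Rep_G3 : Rep 0 3 4 :=
  ⟨G3, G3_mem_ZR, Jac_G3, by simp [G3, v0_FA, v0_FC, map_ofNat]⟩

theorem Rep_G4 : Rep 0 4 3 :=
  ⟨G4, G4_mem_ZR, Jac_G4, by simp [G4, v0_FA, v0_FC, map_ofNat]⟩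

theorem Rep_zero (M : ℕ) : Rep 0 M (12 / Nat.gcd 12 M : ℕ) := by
  have h0 : Rep 0 0 1 := ⟨1, one_mem _, by simpa using Jac.intCast 1, by simp⟩
  have h1 := Rep_FB
  have h2 := Rep_G2
  have h3 := Rep_G3
  have h4 := Rep_G4
  have h5 : Rep 0 5 12 := (h1.mul h4).sub (h2.mul h3)
  have h6 : Rep 0 6 2 := (h2.mul h4).sub (h3.mul h3)
  have h7 : Rep 0 7 12 := h3.mul h4
  have h8 : Rep 0 8 3 := (h2.mul h6).sub (h4.mul h4)
  have h9 : Rep 0 9 4 := (h1.mul h8).sub ((h3.mul h6).int_mul 4)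
  have h10 : Rep 0 10 6 := h4.mul h6
  have h11 : Rep 0 11 12 := h3.mul h8
  have h12 : Rep 0 12 1 := (h4.mul h8).sub ((h6.mul h6).int_mul 2)
  have key : ∀ n r c, Rep 0 r c → Rep 0 (r + 12 * n) c := by
    intro n
    induction n with
    | zero => intro r c h; exact h
    | succ n ih => intro r c h; exact ((ih r c h).mul h12).cast rfl rfl (mul_one c)
  have hM : M = M % 12 + 12 * (M / 12) := (Nat.mod_add_div M 12).symm
  have hg : Nat.gcd 12 M = Nat.gcd 12 (M % 12) := by rw [Nat.gcd_rec 12 M, Nat.gcd_comm]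
  have hr := Nat.mod_lt M (by norm_num : 0 < 12)
  rw [hg]
  generalize M % 12 = r at hM hr
  rw [hM]
  refine key _ r _ ?_
  interval_cases r <;> assumption

theorem Rep_of_pair {k : ℤ} {P Q g h : CR} (hP : P ∈ ZR) (hg : g ∈ ZR) (hh : h ∈ ZR)
    (jP : Jac k 0 P) (jQ : Jac (k + 1) 0 Q) (h1 : P - Q = 24 * g)
    (h2 : g + 5 * sg 3 * P = 3 * h) (hv : v0 P = 1) (M : ℕ) : Rep k M 1 := by
  have mA := FA_mem_ZR
  have mC := FC_mem_ZR
  have m3 := sg_mem_ZR 3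
  have mb := sb_mem_ZR
  set f1 := P * FC + 2 * g * FA with hf1
  have j1 : Jac k 1 f1 := by
    refine Jac.of_int_mul (n := 12) (by norm_num) ?_
    have hj := ((jP.mul Jac_FB).cast (k' := k) (m' := 1) (by norm_num) (by norm_num)).sub
      ((jQ.mul Jac_FA).cast (k' := k) (m' := 1) (by ring) (by norm_num))
    convert! hj using 1
    rw [hf1, FB_eq]
    push_cast
    linear_combination -FA * h1
  set f2 := P * FC ^ 2 + 4 * g * FA * FC + h * FA ^ 2 with hf2
  have j2 : Jac k 2 f2 := by
    refine Jac.of_int_mul (n := 144) (by norm_num) ?_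
    have hj := (((jP.mul (Jac_FB.pow 2)).cast (k' := k) (m' := 2) (by norm_num) (by norm_num)).sub
      (((jQ.mul (Jac_FA.mul Jac_FB)).int_mul 2).cast (k' := k) (m' := 2) (by ring)
        (by norm_num))).add
      ((Jac_E4.mul (jP.mul (Jac_FA.pow 2))).cast (k' := k) (m' := 2) (by push_cast; ring)
        (by norm_num))
    convert! hj using 1
    rw [hf2, FB_eq, E4]
    push_cast
    linear_combination (-2 * FA * (FA + 12 * FC)) * h1 - 48 * FA ^ 2 * h2
  set f3 := P * FC ^ 3 + 5 * sg 3 * P * FA ^ 2 * FC + g * FA ^ 2 * FC + 6 * g * FA * FC ^ 2 -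
    10 * sg 3 * g * FA ^ 3 + 2 * sb * P * FA ^ 3 with hf3
  have j3 : Jac k 3 f3 := by
    refine Jac.of_int_mul (n := 2) (by norm_num) ?_
    have hj := ((j1.mul Jac_G2).cast (k' := k) (m' := 3) (by norm_num) (by norm_num)).sub
      ((jP.mul Jac_G3).cast (k' := k) (m' := 3) (by norm_num) (by norm_num))
    convert! hj using 1
    rw [hf3, hf1, G2, G3]
    push_cast
    ring
  have r0 : Rep k 0 1 := ⟨P, hP, jP, by simp [hv]⟩
  have r1 : Rep k 1 1 := ⟨f1, by
    with_reducible
      rw [hf1]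
      repeat' first
        | assumption | apply add_mem | apply sub_mem | apply mul_mem | apply pow_mem
        | apply ofNat_mem, j1, by simp [hf1, v0_FA, v0_FC, hv]⟩
  have r2 : Rep k 2 1 := ⟨f2, by
    with_reducible
      rw [hf2]
      repeat' first
        | assumption | apply add_mem | apply sub_mem | apply mul_mem | apply pow_mem
        | apply ofNat_mem, j2, by simp [hf2, v0_FA, v0_FC, hv]⟩
  have r3 : Rep k 3 1 := ⟨f3, by
    with_reducible
      rw [hf3]
      repeat' first
        | assumption | apply add_mem | apply sub_mem | apply mul_mem | apply pow_mem
        | apply ofNat_mem, j3, by simp [hf3, v0_FA, v0_FC, hv]⟩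
  induction M using Nat.strong_induction_on with
  | _ M ih =>
    match M, ih with
    | 0, _ => exact r0
    | 1, _ => exact r1
    | 2, _ => exact r2
    | 3, _ => exact r3
    | M + 4, ih =>
      exact (((ih (M + 1) (by omega)).mul Rep_G3).cast (add_zero k) (by ring) rfl).sub
        (((ih M (by omega)).mul Rep_G4).cast (k' := k) (m' := M + 4) (add_zero k) rfl rfl)

theorem Rep_one {k : ℤ} (hk : 2 ≤ k) (M : ℕ) : Rep k M 1 := by
  have m3 := sg_mem_ZR 3
  have mb := sb_mem_ZR
  have h2 : ∀ M, Rep 2 M 1 := by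
    refine Rep_of_pair (P := E4) (Q := E6) (g := 36 * sb - 5 * sg 3)
      (h := 12 * sb + 400 * sg 3 ^ 2) E4_mem_ZR ?_ ?_ Jac_E4 Jac_E6 ?_ ?_ v0_E4
    · with_reducible
        repeat' first
          | assumption | apply add_mem | apply sub_mem | apply mul_mem | apply pow_mem
          | apply ofNat_mem
    · with_reducible
        repeat' first
          | assumption | apply add_mem | apply sub_mem | apply mul_mem | apply pow_mem
          | apply ofNat_mem
    · rw [E6_eq, E4]; ring
    · rw [E4]; ring
  have h3 : ∀ M, Rep 3 M 1 := by
    refine Rep_of_pair (P := E6) (Q := E4 ^ 2) (g := -36 * sb - 5 * sg 3 - 2400 * sg 3 ^ 2)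
      (h := -12 * sb - 200 * sg 3 ^ 2 - 1440 * sb * sg 3) E6_mem_ZR ?_ ?_ Jac_E6
      ((Jac_E4.pow 2).cast (by norm_num) (by norm_num)) ?_ ?_ v0_E6
    · with_reducible
        repeat' first
          | assumption | apply neg_mem | apply sub_mem | apply mul_mem | apply pow_mem
          | apply ofNat_mem
    · with_reducible
        repeat' first
          | assumption | apply neg_mem | apply sub_mem | apply mul_mem | apply pow_mem
          | apply ofNat_mem
    · rw [E6_eq, E4]; ring
    · rw [E6_eq]; ring
  have key : ∀ (n : ℕ) {k : ℤ}, Rep k M 1 → Rep (k + 2 * n) M 1 := by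
    intro n k h
    induction n with
    | zero => simpa using h
    | succ n ih =>
      exact (ih.mul ⟨E4, E4_mem_ZR, Jac_E4, by simp [v0_E4]⟩ : Rep _ _ (1 * 1)).cast
        (by push_cast; ring) (by ring) (by ring)
  rcases Int.even_or_odd' k with ⟨a, rfl | rfl⟩
  · refine (key (a - 1).toNat (h2 M)).cast ?_ rfl rfl
    omega
  · refine (key (a - 1).toNat (h3 M)).cast ?_ rfl rfl
    omega

section

variable {k : ℤ} {m : ℕ} {F : CR}

theorem cf_zero_intCast (t : ℤ) : cf 0 (t : CR) = (t : Polynomial ℂ) :=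
  map_intCast (RingHom.mk' (MonoidHom.mk (OneHom.mk (cf 0) cf_zero_one) cf_zero_mul) (cf_add 0)) t

theorem cf_zero_FA_pow_mul (d : ℕ) (ψ : CR) : cf 0 (FA ^ d * ψ) = Polynomial.X ^ d * cf 0 ψ := by
  simp [cf_zero_FA]

theorem Rep.exists_leading {c : ℤ} {d : ℕ} (hd : d ≤ m) (h : Rep (k + d) (m - d) c) (t : ℤ) :
    ∃ ψ ∈ ZR, Jac k m ψ ∧ (∀ i < d, (cf 0 ψ).coeff i = 0) ∧ (cf 0 ψ).coeff d = t * c := by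
  obtain ⟨ψ, h1, h2, h3⟩ := h
  have hcf : cf 0 ((t : CR) * (FA ^ d * ψ)) = Polynomial.C (t : ℂ) * (Polynomial.X ^ d * cf 0 ψ) := by
    rw [cf_zero_mul, cf_zero_FA_pow_mul]
    congr 1
    rw [cf_zero_intCast]; simp
  refine ⟨t * (FA ^ d * ψ), mul_mem (intCast_mem _ _) (mul_mem (pow_mem FA_mem_ZR _) h1),
    (((Jac_FA.pow d).mul h2).cast (by ring) (by omega)).int_mul t, fun i hi => ?_, ?_⟩
  · rw [hcf, Polynomial.coeff_C_mul, Polynomial.coeff_X_pow_mul', if_neg (by omega), mul_zero]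
  · rw [hcf, Polynomial.coeff_C_mul, Polynomial.coeff_X_pow_mul', if_pos le_rfl, Nat.sub_self,
      ← v0_apply, h3]

/-- Polynomials with integral coefficients. -/
def ZP : Subring (Polynomial ℂ) := (Polynomial.mapRingHom (Int.castRingHom ℂ)).range

theorem mem_ZP_iff {P : Polynomial ℂ} :
    P ∈ ZP ↔ ∃ Q : Polynomial ℤ, Q.map (Int.castRingHom ℂ) = P := Iff.rfl

theorem cf_mem_ZP (hF : F ∈ ZR) (n : ℕ) : cf n F ∈ ZP := mem_ZR_iff.mp hF n

theorem coeff_of_mem_ZP {P : Polynomial ℂ} (hP : P ∈ ZP) (i : ℕ) : ∃ c : ℤ, P.coeff i = c := by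
  obtain ⟨Q, rfl⟩ := mem_ZP_iff.mp hP
  exact ⟨Q.coeff i, by simp⟩

theorem exists_same_of_two_le (d : ℕ) (hF : Jac k m F) (hd : ∀ i < d, (cf 0 F).coeff i = 0)
    (hk : 2 ≤ k + d) (hint : cf 0 F ∈ ZP) : ∃ ψ ∈ ZR, Jac k m ψ ∧ cf 0 ψ = cf 0 F := by
  obtain ⟨n, hn⟩ : ∃ n, n = m + 1 - d := ⟨_, rfl⟩
  induction n generalizing d F with
  | zero =>
    refine ⟨0, zero_mem _, by simpa using hF.sub hF, ?_⟩
    rw [hF.cf_zero_eq_zero fun i hi => hd i (by omega), cf_zero']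
  | succ n ih =>
    obtain ⟨p, hp⟩ := coeff_of_mem_ZP hint d
    obtain ⟨ψ, h1, h2, h3, h4⟩ := (Rep_one hk (m - d)).exists_leading (by omega) p
    obtain ⟨ψ', h1', h2', h3'⟩ := ih (F := F - ψ) (d + 1) (hF.sub h2) (fun i hi => by
        rw [cf_sub, Polynomial.coeff_sub]
        rcases Nat.lt_succ_iff_lt_or_eq.mp hi with hi | rfl
        · rw [hd i hi, h3 i hi, sub_zero]
        · rw [hp, h4]; simp) (by push_cast; omega)
      (by rw [cf_sub]; exact sub_mem hint (cf_mem_ZP h1 0)) (by omega)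
    exact ⟨ψ + ψ', add_mem h1 h1', h2.add h2', by rw [cf_add, h3', cf_sub]; ring⟩

theorem dvd_of_twelve_mul {p p' : ℤ} {M : ℕ} (h : 12 * p' = M * p) :
    ((12 / Nat.gcd 12 M : ℕ) : ℤ) ∣ p := by
  have hg : 0 < Nat.gcd 12 M := Nat.gcd_pos_of_pos_left _ (by norm_num)
  have hc : Nat.Coprime (12 / Nat.gcd 12 M) (M / Nat.gcd 12 M) := Nat.coprime_div_gcd_div_gcd hg
  have h1 : 12 / Nat.gcd 12 M * Nat.gcd 12 M = 12 := Nat.div_mul_cancel (Nat.gcd_dvd_left _ _)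
  have h2 : M / Nat.gcd 12 M * Nat.gcd 12 M = M := Nat.div_mul_cancel (Nat.gcd_dvd_right _ _)
  refine (Int.isCoprime_iff_gcd_eq_one.mpr ?_ : IsCoprime ((12 / Nat.gcd 12 M : ℕ) : ℤ)
    ((M / Nat.gcd 12 M : ℕ) : ℤ)).dvd_of_dvd_mul_left ⟨p', ?_⟩
  · rw [Int.gcd_natCast_natCast]; exact hc
  · have hg' : ((Nat.gcd 12 M : ℕ) : ℤ) ≠ 0 := by exact_mod_cast hg.ne'
    apply mul_left_cancel₀ hg'
    have h1' : ((12 / Nat.gcd 12 M : ℕ) : ℤ) * (Nat.gcd 12 M : ℕ) = 12 := by exact_mod_cast h1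
    have h2' : ((M / Nat.gcd 12 M : ℕ) : ℤ) * (Nat.gcd 12 M : ℕ) = M := by exact_mod_cast h2
    linear_combination -h + p * h2' - p' * h1'

theorem lead_twelve {d : ℕ} (hF : Jac k m F) (hk : k + d = 0) (hd : d ≤ m)
    {p : ℤ} (hp : (cf 0 F).coeff d = p) :
    12 * (cf 0 F).coeff (d + 1) = (m - d : ℕ) * p := by
  set M := m - d with hM
  have hH : Jac k m (((12 ^ M : ℤ) : CR) * F - (p : CR) * (FA ^ d * FB ^ M)) :=
    (hF.int_mul _).sub ((((Jac_FA.pow d).mul (Jac_FB.pow M)).cast (by omega) (by omega)).int_mul p)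
  set H := ((12 ^ M : ℤ) : CR) * F - (p : CR) * (FA ^ d * FB ^ M) with hHd
  have hcf : ∀ i, (cf 0 H).coeff i = 12 ^ M * (cf 0 F).coeff i -
      p * (Polynomial.X ^ d * (Polynomial.X + Polynomial.C 12) ^ M : Polynomial ℂ).coeff i := by
    intro i
    rw [hHd, cf_sub, cf_zero_mul, cf_zero_mul, cf_zero_intCast, cf_zero_intCast,
      cf_zero_FA_pow_mul, cf_zero_pow, cf_zero_FB]
    have h1 : ((12 ^ M : ℤ) : Polynomial ℂ) = Polynomial.C (12 ^ M) := by
      rw [Polynomial.C_pow]; push_cast; rfl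
    have h2 : (p : Polynomial ℂ) = Polynomial.C (p : ℂ) := by simp
    rw [h1, h2, Polynomial.coeff_sub, Polynomial.coeff_C_mul, Polynomial.coeff_C_mul]
    rfl
  have h0 := lead_zero_of_neg hH (d := d) (by omega)
  have h1 : ∀ n, ∀ i < d + 1, (cf n H).coeff i = 0 := by
    intro n i hi
    rcases Nat.lt_succ_iff_lt_or_eq.mp hi with hi | rfl
    · exact h0 n i hi
    · cases n with
      | succ n => exact lead_const hH h0 hk n
      | zero =>
        rw [hcf, hp, Polynomial.coeff_X_pow_mul', if_pos le_rfl, Nat.sub_self,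
          Polynomial.coeff_X_add_C_pow]
        simp
        ring
  have h2 := lead_zero hH h1 (Or.inr (by push_cast; omega)) 0
  rw [hcf, Polynomial.coeff_X_pow_mul', if_pos (by omega), Nat.add_sub_cancel_left,
    Polynomial.coeff_X_add_C_pow, Nat.choose_one_right] at h2
  have h12 : (12 : ℂ) ^ M ≠ 0 := pow_ne_zero _ (by norm_num)
  apply mul_left_cancel₀ h12
  rcases Nat.eq_zero_or_pos M with hM0 | hM0
  · rw [hM0] at h2 ⊢
    simp at h2 ⊢
    exact h2
  · obtain ⟨M', hM'⟩ : ∃ M', M = M' + 1 := ⟨M - 1, by omega⟩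
    rw [hM'] at h2 ⊢
    rw [Nat.add_sub_cancel] at h2
    linear_combination 12 * h2

theorem exists_same (hF : Jac k m F) (hk : 0 ≤ k + m) (hint : cf 0 F ∈ ZP) :
    ∃ ψ ∈ ZR, Jac k m ψ ∧ cf 0 ψ = cf 0 F := by
  rcases le_or_gt 2 k with h2 | h2
  · exact exists_same_of_two_le 0 hF (by simp) (by simpa using h2) hint
  rcases eq_or_ne k 1 with h1 | h1
  · exact exists_same_of_two_le 1 hF (fun i hi => lead_zero hF (fun n j hj => by omega)
      (Or.inr (by omega)) 0) (by push_cast; omega) hint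
  obtain ⟨d, hd⟩ : ∃ d : ℕ, k + d = 0 := ⟨(-k).toNat, by omega⟩
  have hdm : d ≤ m := by omega
  obtain ⟨p, hp⟩ := coeff_of_mem_ZP hint d
  obtain ⟨p', hp'⟩ := coeff_of_mem_ZP hint (d + 1)
  have h12 := lead_twelve hF hd hdm hp
  rw [hp'] at h12
  obtain ⟨t, ht⟩ := dvd_of_twelve_mul (p := p) (p' := p') (M := m - d) (by exact_mod_cast h12)
  obtain ⟨ψ, g1, g2, g3, g4⟩ :=
    ((Rep_zero (m - d)).cast hd.symm rfl rfl).exists_leading hdm t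
  have hJ := hF.sub g2
  have k0 := lead_zero_of_neg hJ (d := d) (by omega)
  have k1 : ∀ n, ∀ i < d + 1, (cf n (F - ψ)).coeff i = 0 := by
    intro n i hi
    rcases Nat.lt_succ_iff_lt_or_eq.mp hi with hi | rfl
    · exact k0 n i hi
    · cases n with
      | succ n => exact lead_const hJ k0 hd n
      | zero =>
        rw [cf_sub, Polynomial.coeff_sub, hp, g4, ht]
        push_cast
        ring
  have k2 := lead_zero hJ k1 (Or.inr (by push_cast; omega)) 0
  obtain ⟨ψ', h1', h2', h3'⟩ := exists_same_of_two_le (d + 2) hJ (fun i hi => by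
    rcases Nat.lt_succ_iff_lt_or_eq.mp hi with hi | rfl
    · exact k1 0 i hi
    · exact k2) (by push_cast; omega) (by rw [cf_sub]; exact sub_mem hint (cf_mem_ZP g1 0))
  exact ⟨ψ + ψ', add_mem g1 h1', g2.add h2', by rw [cf_add, h3', cf_sub]; ring⟩

theorem mem_ZR_of_integral (n : ℕ) (hF : Jac k m F) (hk : k + m < 6 * n)
    (hint : ∀ j < n, cf j F ∈ ZP) : F ∈ ZR := by
  induction n generalizing k F with
  | zero => rw [hF.eq_zero (by simpa using hk)]; exact zero_mem _
  | succ n ih =>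
    rcases lt_or_ge (k + m) 0 with hneg | hpos
    · rw [hF.eq_zero hneg]; exact zero_mem _
    obtain ⟨ψ, h1, h2, h3⟩ := exists_same hF hpos (hint 0 (by omega))
    obtain ⟨G, hG⟩ := exists_eq_qX_mul (F := F - ψ) (by rw [cf_sub, h3, sub_self])
    have hJ : Jac k m (qX * G) := hG ▸ hF.sub h2
    have hD : G * DI ∈ ZR := by
      refine ih hJ.mul_DI (by push_cast at hk; omega) fun j hj => ?_
      rw [cf_mul]
      refine sum_mem fun x hx => mul_mem ?_ (cf_mem_ZP DI_mem_ZR _)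
      have := Finset.HasAntidiagonal.mem_antidiagonal.mp hx
      rw [← cf_succ_qX_mul, ← hG, cf_sub]
      exact sub_mem (hint _ (by omega)) (cf_mem_ZP h1 _)
    have hG' : G = G * DI * DD := by rw [mul_assoc, DI_mul_DD, mul_one]
    have hF' : F = qX * (G * DI * DD) + ψ := by rw [← hG', ← hG]; ring
    rw [hF']
    exact add_mem (mul_mem qX_mem_ZR (mul_mem hD DD_mem_ZR)) h1

theorem integral_of_isWeakJacobiForm {φ : ℂ → ℂ → ℂ} {f : ℕ → ℤ → ℂ} (hφ : IsWeakJacobiForm (2 * k) m φ f)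
    (hint : ∀ n : ℕ, (n : ℤ) ≤ Int.fdiv ((m : ℤ) + k) 6 → ∀ l : ℤ, ∃ c : ℤ, f n l = (c : ℂ))
    (n : ℕ) (l : ℤ) : ∃ c : ℤ, f n l = (c : ℂ) := by
  obtain ⟨F, hF, hlc, hZ⟩ := exists_CR_of_weakJacobi hφ
  rw [Int.fdiv_eq_ediv_of_nonneg _ (by norm_num)] at hint
  have hmem : F ∈ ZR := mem_ZR_of_integral (((m : ℤ) + k) / 6 + 1).toNat hF (by omega)
    fun j hj => mem_ZP_iff.mpr (hZ j (hint j (by omega)))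
  obtain ⟨P, hP⟩ := mem_ZR_iff.mp hmem n
  rw [← hlc, ← hP]
  exact lc_integral l P

end

end

/-- Theorem 3.2 of Gritsenko–Wang: Let `k ∈ ℤ` and `m ≥ 1`, and let `φ` be a
weak Jacobi form of weight `2k` and index `m` with Fourier coefficients `f(n,l)`. If
`f(n,l) ∈ ℤ` for all `0 ≤ n ≤ ⌊(m+k)/6⌋` and all `l ∈ ℤ`, then all `f(n,l)` are integers. -/
theorem integrality_criterion_weak_jacobi (k : ℤ) (m : ℕ) (hm : 1 ≤ m)
    (φ : ℂ → ℂ → ℂ) (f : ℕ → ℤ → ℂ)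
    (hφ : IsWeakJacobiForm (2 * k) m φ f)
    (hint : ∀ n : ℕ, (n : ℤ) ≤ Int.fdiv ((m : ℤ) + k) 6 → ∀ l : ℤ, ∃ c : ℤ, f n l = (c : ℂ)) :
    ∀ n : ℕ, ∀ l : ℤ, ∃ c : ℤ, f n l = (c : ℂ) :=
  integral_of_isWeakJacobiForm hφ hint

end JacobiPaper
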